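/- arXiv:1909.13029 — 13 statements merged into one kernel-verified Lean document; each statement's English description precedes it below -/
import Mathlib

section
/- Every paired threshold graph is an interval graph. -/
/-- `G` is a paired threshold graph: there are positive vertex weights and two
positive thresholds such that distinct vertices are adjacent iff their weight
sum is at least `Tp` and their weight difference is at most `Tm`. -/
def IsPairedThresholdGraph {V : Type*} (G : SimpleGraph V) : Prop :=
  ∃ (w : V → ℝ) (Tp Tm : ℝ), (∀ v, 0 < w v) ∧ 0 < Tp ∧ 0 < Tm ∧
    ∀ u v, u ≠ v → (G.Adj u v ↔ Tp ≤ w u + w v ∧ |w u - w v| ≤ Tm)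

/-- `G` is an interval graph: vertices can be assigned nonempty closed real
intervals so that distinct vertices are adjacent iff their intervals meet. -/
def IsIntervalGraph {V : Type*} (G : SimpleGraph V) : Prop :=
  ∃ l r : V → ℝ, (∀ v, l v ≤ r v) ∧
    ∀ u v, u ≠ v →
      (G.Adj u v ↔ (Set.Icc (l u) (r u) ∩ Set.Icc (l v) (r v)).Nonempty)

/-- `G` is a unit interval graph: vertices can be assigned closed real intervals
of length one so that distinct vertices are adjacent iff their intervals meet. -/
def IsUnitIntervalGraph {V : Type*} (G : SimpleGraph V) : Prop :=
  ∃ l : V → ℝ,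
    ∀ u v, u ≠ v →
      (G.Adj u v ↔ (Set.Icc (l u) (l u + 1) ∩ Set.Icc (l v) (l v + 1)).Nonempty)

/-- `G` is a threshold graph: there are positive vertex weights and a positive
threshold such that distinct vertices are adjacent iff their weight sum is at
least `T`. -/
def IsThresholdGraph {V : Type*} (G : SimpleGraph V) : Prop :=
  ∃ (w : V → ℝ) (T : ℝ), (∀ v, 0 < w v) ∧ 0 < T ∧
    ∀ u v, u ≠ v → (G.Adj u v ↔ T ≤ w u + w v)

/-- Closed neighborhood `N[X]` of a vertex set. -/
def closedNbhd {V : Type*} (G : SimpleGraph V) (X : Set V) : Set V :=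
  X ∪ {u | ∃ x ∈ X, G.Adj x u}

/-- Open neighborhood `N(X)` of a vertex set. -/
def openNbhd {V : Type*} (G : SimpleGraph V) (X : Set V) : Set V :=
  closedNbhd G X \ X

/-- A vertex is simplicial if its closed neighborhood is a clique. -/
def IsSimplicial {V : Type*} (G : SimpleGraph V) (v : V) : Prop :=
  G.IsClique (insert v (G.neighborSet v))

/-- A broom ordering of `G` (vertices indexed `0, …, n-1` by the bijection `σ`):
the reversal of `σ` is an interval ordering, and there is `p` such that the first
`p` vertices have all their neighbors after position `p`, occupying consecutive
positions, while the last `n - p` vertices form an umbrella ordering. -/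
def IsBroomOrdering {V : Type*} [Fintype V] (G : SimpleGraph V)
    (σ : V ≃ Fin (Fintype.card V)) : Prop :=
  (∀ x y z : V, σ x < σ y → σ y < σ z → G.Adj x z → G.Adj y z) ∧
  ∃ p : ℕ, p ≤ Fintype.card V ∧
    (∀ u : V, (σ u : ℕ) < p →
      (∀ v : V, G.Adj u v → p ≤ (σ v : ℕ)) ∧
      (∀ a b c : Fin (Fintype.card V),
        (∃ x, G.Adj u x ∧ σ x = a) → (∃ x, G.Adj u x ∧ σ x = c) →
        a ≤ b → b ≤ c → ∃ x, G.Adj u x ∧ σ x = b)) ∧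
    (∀ x y z : V, p ≤ (σ x : ℕ) → σ x < σ y → σ y < σ z →
      G.Adj x z → G.Adj x y ∧ G.Adj y z)

/-- An umbrella ordering of a graph `H`. -/
def IsUmbrellaOrdering {W : Type*} (H : SimpleGraph W) (σ : W ≃ Fin (Nat.card W)) : Prop :=
  ∀ x y z : W, σ x < σ y → σ y < σ z → H.Adj x z → H.Adj x y ∧ H.Adj y z

/-- `I ⊎ U` is a paired threshold partition of `G`. -/
def IsPairedThresholdPartition {V : Type*} (G : SimpleGraph V) (I U : Set V) : Prop :=
  I ∪ U = Set.univ ∧ Disjoint I U ∧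
  (∀ x ∈ I, ∀ y ∈ I, ¬ G.Adj x y) ∧
  IsUnitIntervalGraph (G.induce U) ∧
  IsThresholdGraph (G.induce (closedNbhd G I)) ∧
  ∃ σ : ↥U ≃ Fin (Nat.card ↥U),
    IsUmbrellaOrdering (G.induce U) σ ∧
    (∀ v ∈ I, ∀ a b c : Fin (Nat.card ↥U),
      (∃ x : ↥U, G.Adj v ↑x ∧ σ x = a) → (∃ x : ↥U, G.Adj v ↑x ∧ σ x = c) →
      a ≤ b → b ≤ c → ∃ x : ↥U, G.Adj v ↑x ∧ σ x = b) ∧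
    (∀ u : ↥U, (σ u : ℕ) = 0 → openNbhd G I ⊆ insert (↑u) (G.neighborSet ↑u))

/-- A canonical paired threshold partition: `I` cannot be enlarged by moving a
vertex of `U` into it. -/
def IsCanonicalPTPartition {V : Type*} (G : SimpleGraph V) (I U : Set V) : Prop :=
  IsPairedThresholdPartition G I U ∧
  ∀ v ∈ U, ¬ IsPairedThresholdPartition G (insert v I) (U \ {v})

/-- A maximal clique of `G`. -/
def IsMaximalClique {V : Type*} (G : SimpleGraph V) (s : Set V) : Prop :=
  G.IsClique s ∧ ∀ t : Set V, G.IsClique t → s ⊆ t → s = t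

/-- A clique path of `G`: a sequence listing each maximal clique exactly once,
in which the cliques containing any fixed vertex occur consecutively. -/
def IsCliquePath {V : Type*} (G : SimpleGraph V) {ℓ : ℕ} (C : Fin ℓ → Set V) : Prop :=
  Function.Injective C ∧
  (∀ i, IsMaximalClique G (C i)) ∧
  (∀ s : Set V, IsMaximalClique G s → ∃ i, C i = s) ∧
  (∀ v : V, ∀ i j k : Fin ℓ, i ≤ j → j ≤ k → v ∈ C i → v ∈ C k → v ∈ C j)

open Filter Topology in
/-- Finitely many strict inequalities `f i < g i` survive a common small positive shift. -/
theorem exists_pos_forall_add_lt {ι : Type*} [Finite ι] (f g : ι → ℝ) :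
    ∃ δ > 0, ∀ i, f i < g i → f i + δ < g i := by
  have hev : ∀ᶠ δ in 𝓝[>] (0 : ℝ), ∀ i, f i < g i → f i + δ < g i := by
    refine eventually_all.2 fun i => ?_
    by_cases hi : f i < g i
    · filter_upwards [Ioo_mem_nhdsGT (sub_pos.2 hi)] with δ hδ _
      linarith [hδ.2]
    · exact Eventually.of_forall fun _ h => absurd h hi
  obtain ⟨δ, hδ, hpos⟩ := (hev.and self_mem_nhdsWithin).exists
  exact ⟨δ, hpos, hδ⟩

/-- A finite type injects into the half-open unit interval `(0, 1]`. -/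
theorem exists_injective_pos_le_one (V : Type*) [Finite V] :
    ∃ e : V → ℝ, Function.Injective e ∧ ∀ v, 0 < e v ∧ e v ≤ 1 := by
  obtain ⟨n, ⟨φ⟩⟩ := Finite.exists_equiv_fin V
  refine ⟨fun v => 1 / ((φ v : ℕ) + 1 : ℝ), fun u v huv => ?_, fun v => ⟨by positivity, ?_⟩⟩
  · have : ((φ u : ℕ) : ℝ) = (φ v : ℕ) := by simpa using huv
    exact φ.injective (Fin.ext (by exact_mod_cast this))
  · rw [div_le_one (by positivity)]
    linarith [Nat.cast_nonneg (α := ℝ) (φ v : ℕ)]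

/-- Two nonempty closed intervals meet iff each starts before the other
ends. -/
theorem Icc_inter_Icc_nonempty_iff {a b c d : ℝ} (hab : a ≤ b) (hcd : c ≤ d) :
    (Set.Icc a b ∩ Set.Icc c d).Nonempty ↔ a ≤ d ∧ c ≤ b := by
  rw [Set.Icc_inter_Icc, Set.nonempty_Icc]
  simp [hab, hcd, and_comm]

/-- Every paired threshold graph is an interval graph. -/
theorem paired_threshold_is_interval {V : Type*} [Fintype V] (G : SimpleGraph V)
    (h : IsPairedThresholdGraph G) : IsIntervalGraph G := by
  obtain ⟨w, a, d, -, -, hd, hadj⟩ := h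
  obtain ⟨e, he, he01⟩ := exists_injective_pos_le_one V
  -- A heavy vertex (`a ≤ 2 * w v`) gets `[m v, w v]`; a light one gets a point just above `w v`,
  -- perturbed so that light vertices of equal weight get different points.
  let m : V → ℝ := fun v => max (w v - d) (a - w v)
  obtain ⟨δ, hδ, hgap⟩ := exists_pos_forall_add_lt
    (fun i : V × V × Bool => w i.1) (fun i => if i.2.2 then w i.2.1 else m i.2.1)
  have gap_w (u v : V) (huv : w u < w v) : w u + δ < w v := by
    simpa [huv] using hgap (u, v, true)
  have gap_m (u v : V) (huv : w u < m v) : w u + δ < m v := by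
    simpa [huv] using hgap (u, v, false)
  have shift_pos (v : V) : 0 < δ * e v := mul_pos hδ (he01 v).1
  have shift_le (v : V) : δ * e v ≤ δ := mul_le_of_le_one_right hδ.le (he01 v).2
  let l : V → ℝ := fun v => if a ≤ 2 * w v then m v else w v + δ * e v
  let r : V → ℝ := fun v => if a ≤ 2 * w v then w v else w v + δ * e v
  have hlr (v : V) : l v ≤ r v := by
    by_cases hv : a ≤ 2 * w v
    · simp only [l, r, m, hv, if_true]
      exact max_le (by linarith) (by linarith)
    · simp [l, r, hv]
  have light_heavy (u v : V) (hu : ¬ a ≤ 2 * w u) (hv : a ≤ 2 * w v) :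
      (a ≤ w u + w v ∧ |w u - w v| ≤ d) ↔ l u ≤ r v ∧ l v ≤ r u := by
    simp only [l, r, hu, hv, if_true, if_false]
    have hw : w u < w v := by linarith
    have hm : m v ≤ w u + δ * e u ↔ m v ≤ w u :=
      ⟨fun h => not_lt.1 fun hlt => by linarith [gap_m u v hlt, shift_le u],
        fun h => by linarith [shift_pos u]⟩
    rw [hm, max_le_iff, abs_le]
    constructor
    · rintro ⟨h₁, h₂, -⟩
      exact ⟨by linarith [gap_w u v hw, shift_le u], by linarith, by linarith⟩
    · rintro ⟨-, h₁, h₂⟩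
      exact ⟨by linarith, by linarith, by linarith⟩
  refine ⟨l, r, hlr, fun u v huv => ?_⟩
  rw [hadj u v huv, Icc_inter_Icc_nonempty_iff (hlr u) (hlr v)]
  by_cases hu : a ≤ 2 * w u <;> by_cases hv : a ≤ 2 * w v
  · simp only [l, r, m, hu, hv, if_true, max_le_iff, abs_le]
    constructor
    · rintro ⟨-, h₁, h₂⟩
      refine ⟨⟨?_, ?_⟩, ?_, ?_⟩ <;> linarith
    · rintro ⟨⟨h₁, -⟩, h₂, -⟩
      refine ⟨?_, ?_, ?_⟩ <;> linarith
  · rw [add_comm, abs_sub_comm, light_heavy v u hv hu, and_comm]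
  · exact light_heavy u v hu hv
  · simp only [l, r, hu, hv, if_false]
    refine iff_of_false (fun h => by linarith [h.1]) fun h => ?_
    rcases lt_trichotomy (w u) (w v) with hlt | heq | hlt
    · linarith [gap_w u v hlt, shift_le u, shift_pos v, h.2]
    · have : δ * e u = δ * e v := by linarith [h.1, h.2]
      exact huv (he (mul_left_cancel₀ hδ.ne' this))
    · linarith [gap_w v u hlt, shift_le v, shift_pos u, h.1]
end

section
/- Let G = (V, E) be a finite simple graph, w : V → ℝ a positive weight function, and T₊, T₋ > 0 thresholds such that distinct vertices u, v are adjacent if and only if w(u) + w(v) ≥ T₊ and |w(u) − w(v)| ≤ T₋. Then every vertex of minimum weight is a simplicial vertex of G. -/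
/-- In a paired threshold representation, every vertex of minimum
weight is simplicial. -/
theorem min_weight_vertex_simplicial {V : Type*} [Fintype V] (G : SimpleGraph V)
    (w : V → ℝ) (Tp Tm : ℝ) (hw : ∀ v, 0 < w v) (hTp : 0 < Tp) (hTm : 0 < Tm)
    (hadj : ∀ u v, u ≠ v → (G.Adj u v ↔ Tp ≤ w u + w v ∧ |w u - w v| ≤ Tm))
    (v : V) (hmin : ∀ u, w v ≤ w u) : IsSimplicial G v := by
  have bounds : ∀ x, G.Adj v x → Tp ≤ w v + w x ∧ w x - w v ≤ Tm := fun x hx =>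
    have h := (hadj v x hx.ne).1 hx
    ⟨h.1, by linarith [(abs_le.1 h.2).1]⟩
  refine SimpleGraph.isClique_insert.2 ⟨fun x hx y hy hxy => ?_, fun _ hx _ => hx⟩
  obtain ⟨hx₁, hx₂⟩ := bounds x hx
  obtain ⟨_, hy₂⟩ := bounds y hy
  have hx₀ := hmin x
  have hy₀ := hmin y
  exact (hadj x y hxy).2 ⟨by linarith, abs_le.2 ⟨by linarith, by linarith⟩⟩
end

section
/- A finite simple graph G = (V, E) is a paired threshold graph if and only if there exist a weight function w : V → ℝ with w(v) > 0 for all v ∈ V and a single threshold T > 0 such that for all distinct u, v ∈ V, uv ∈ E if and only if w(u) + w(v) ≥ T and |w(u) − w(v)| ≤ T. -/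
/-- Finitely many strict inequalities `f i < a` can be strengthened by a common margin. -/
theorem exists_pos_forall_lt_sub {ι : Type*} [Finite ι] (f : ι → ℝ) (a : ℝ) :
    ∃ ε > 0, ∀ i, f i < a → f i < a - ε := by
  have h : ∀ᶠ ε in nhdsWithin (0 : ℝ) (Set.Ioi 0), ∀ i, f i < a → f i < a - ε := by
    refine Filter.eventually_all.2 fun i => ?_
    by_cases hi : f i < a
    · filter_upwards [Ioo_mem_nhdsGT (sub_pos.2 hi)] with ε hε _
      linarith [hε.2]
    · exact Filter.Eventually.of_forall fun _ h => absurd h hi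
  obtain ⟨ε, hε, hpos⟩ := (h.and self_mem_nhdsWithin).exists
  exact ⟨ε, hpos, hε⟩

/-- A single-threshold representation by arbitrary real weights can be made positive: vertices of
negative weight are isolated and get large, widely spaced weights, while the others are shifted up
by a small amount. -/
theorem exists_pos_weight_of_single_threshold {V : Type*} [Finite V] (G : SimpleGraph V)
    (x : V → ℝ) (T : ℝ) (hT : 0 < T)
    (hG : ∀ u v, u ≠ v → (G.Adj u v ↔ T ≤ x u + x v ∧ |x u - x v| ≤ T)) :
    ∃ (w : V → ℝ) (T : ℝ), (∀ v, 0 < w v) ∧ 0 < T ∧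
      ∀ u v, u ≠ v → (G.Adj u v ↔ T ≤ w u + w v ∧ |w u - w v| ≤ T) := by
  classical
  obtain ⟨ε₁, hε₁, hsum⟩ := exists_pos_forall_lt_sub (fun p : V × V => x p.1 + x p.2) T
  obtain ⟨ε₂, hε₂, hdiff⟩ := exists_pos_forall_lt_sub (fun p : V × V => -|x p.1 - x p.2|) (-T)
  obtain ⟨ε, hε, hle₁, hle₂⟩ : ∃ ε > 0, ε ≤ ε₁ ∧ ε ≤ ε₂ :=
    ⟨min ε₁ ε₂, lt_min hε₁ hε₂, min_le_left _ _, min_le_right _ _⟩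
  obtain ⟨B, hB⟩ := (Set.finite_range x).bddAbove
  obtain ⟨M, hM, hxM⟩ : ∃ M, 0 ≤ M ∧ ∀ v, x v ≤ M :=
    ⟨max B 0, le_max_right _ _, fun v => (hB ⟨v, rfl⟩).trans (le_max_left _ _)⟩
  obtain ⟨n, ⟨f⟩⟩ := Finite.exists_equiv_fin V
  let spread : V → ℝ := fun v => M + ε + 2 * (T + ε) * ((f v : ℕ) + 1)
  have hspread : ∀ v, M + ε + 2 * (T + ε) ≤ spread v := fun v => by
    have : 0 ≤ (T + ε) * ((f v : ℕ) : ℝ) := by positivity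
    simp only [spread]
    linarith
  have hspread_sep : ∀ u v, u ≠ v → T + ε < |spread u - spread v| := fun u v huv => by
    have hne : ((f u : ℕ) : ℤ) - ((f v : ℕ) : ℤ) ≠ 0 := fun h =>
      huv (f.injective (Fin.ext (by omega)))
    have hone : (1 : ℝ) ≤ |((f u : ℕ) : ℝ) - ((f v : ℕ) : ℝ)| := by
      exact_mod_cast Int.one_le_abs hne
    have heq : spread u - spread v = 2 * (T + ε) * (((f u : ℕ) : ℝ) - ((f v : ℕ) : ℝ)) := by
      simp only [spread]
      ring
    rw [heq, abs_mul, abs_of_pos (by positivity)]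
    nlinarith
  have hisolated : ∀ u v, x u < 0 → ¬ G.Adj u v := fun u v hu h => by
    obtain ⟨h₁, h₂⟩ := (hG u v h.ne).1 h
    linarith [(abs_le.1 h₂).1]
  refine ⟨fun v => if x v < 0 then spread v else x v + ε, T + ε, fun v => ?_, by positivity,
    fun u v huv => ?_⟩
  · dsimp only
    split_ifs
    · linarith [hspread v]
    · linarith
  · dsimp only
    split_ifs with hu hv hv
    · exact iff_of_false (hisolated u v hu) fun h => (hspread_sep u v huv).not_ge h.2
    · refine iff_of_false (hisolated u v hu) fun h => ?_
      linarith [(abs_le.1 h.2).2, hspread u, hxM v]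
    · refine iff_of_false (fun h => hisolated v u hv h.symm) fun h => ?_
      linarith [(abs_le.1 h.2).1, hspread v, hxM u]
    · rw [hG u v huv, add_sub_add_right_eq_sub]
      refine and_congr ⟨fun h => by linarith, fun h => ?_⟩ ⟨fun h => by linarith, fun h => ?_⟩
      · by_contra! hlt
        have := hsum (u, v) hlt
        dsimp only at this
        linarith
      · by_contra! hlt
        have := hdiff (u, v) (neg_lt_neg hlt)
        dsimp only at this
        linarith

/-- `G` is a paired threshold graph iff it has a representation
with a single threshold used for both the sum and the difference condition. -/
theorem paired_threshold_iff_single_threshold {V : Type*} [Fintype V] (G : SimpleGraph V) :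
    IsPairedThresholdGraph G ↔
      ∃ (w : V → ℝ) (T : ℝ), (∀ v, 0 < w v) ∧ 0 < T ∧
        ∀ u v, u ≠ v → (G.Adj u v ↔ T ≤ w u + w v ∧ |w u - w v| ≤ T) := by
  constructor
  · rintro ⟨w, Tp, Tm, -, -, hTm, hG⟩
    refine exists_pos_weight_of_single_threshold G (fun v => w v + (Tm - Tp) / 2) Tm hTm
      fun u v huv => ?_
    rw [hG u v huv, add_sub_add_right_eq_sub]
    exact and_congr_left' ⟨fun h => by linarith, fun h => by linarith⟩
  · rintro ⟨w, T, hw, hT, hG⟩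
    exact ⟨w, T, T, hw, hT, hT, hG⟩
end

section
/- Let G = (V, E) be a finite simple graph, w : V → ℝ a positive weight function, and T > 0 a threshold such that distinct vertices u, v are adjacent if and only if w(u) + w(v) ≥ T and |w(u) − w(v)| ≤ T. Then the subgraph of G induced by the vertex set {v ∈ V : w(v) ≥ T/2} is a unit interval graph. -/
/-- In a paired threshold graph realized by `w` and `T`, the
subgraph induced by the vertices of weight at least `T/2` is a unit interval
graph. -/
theorem heavy_vertices_unit_interval {V : Type*} [Fintype V] (G : SimpleGraph V)
    (w : V → ℝ) (T : ℝ) (hw : ∀ v, 0 < w v) (hT : 0 < T)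
    (hadj : ∀ u v, u ≠ v → (G.Adj u v ↔ T ≤ w u + w v ∧ |w u - w v| ≤ T)) :
    IsUnitIntervalGraph (G.induce {v | T / 2 ≤ w v}) := by
  refine ⟨fun v => w v / T, fun u v huv => ?_⟩
  have hu : T / 2 ≤ w u := u.2
  have hv : T / 2 ≤ w v := v.2
  have add_one (x : ℝ) : x / T + 1 = (x + T) / T := by field_simp
  rw [SimpleGraph.comap_adj, Function.Embedding.subtype_apply, Function.Embedding.subtype_apply,
    hadj u v (Subtype.coe_ne_coe.mpr huv), Set.Icc_inter_Icc, Set.nonempty_Icc]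
  simp only [sup_le_iff, le_inf_iff, add_one, div_le_div_iff_of_pos_right hT, abs_le]
  constructor
  · rintro ⟨-, h₁, h₂⟩
    refine ⟨⟨?_, ?_⟩, ?_, ?_⟩ <;> linarith
  · rintro ⟨⟨-, h₁⟩, h₂, -⟩
    refine ⟨?_, ?_, ?_⟩ <;> linarith
end

section
/- Every unit interval graph G is a paired threshold graph; moreover, there exist a positive weight function w on V(G) and a threshold T > 0 realizing G as a paired threshold graph such that w(v) ≥ T for every vertex v of G. -/
/-- Every unit interval graph is a paired threshold graph;
moreover there is a realization in which every weight is at least the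
threshold. -/
theorem unit_interval_is_paired_threshold {V : Type*} [Fintype V] (G : SimpleGraph V)
    (h : IsUnitIntervalGraph G) :
    ∃ (w : V → ℝ) (T : ℝ), (∀ v, 0 < w v) ∧ 0 < T ∧
      (∀ u v, u ≠ v → (G.Adj u v ↔ T ≤ w u + w v ∧ |w u - w v| ≤ T)) ∧
      ∀ v, T ≤ w v := by
  obtain ⟨l, hl⟩ := h
  obtain ⟨m, hm⟩ := (Set.finite_range l).bddBelow
  have hw : ∀ v, 1 ≤ l v - m + 1 := fun v => by
    linarith [hm (Set.mem_range_self v)]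
  refine ⟨fun v => l v - m + 1, 1, fun v => by linarith [hw v], one_pos, fun u v huv => ?_, hw⟩
  rw [hl u v huv, Set.Icc_inter_Icc, Set.nonempty_Icc, sup_le_iff, le_inf_iff, le_inf_iff, abs_le]
  constructor
  · rintro ⟨⟨-, h₁⟩, h₂, -⟩
    refine ⟨?_, ?_, ?_⟩ <;> linarith [hw u, hw v]
  · rintro ⟨-, h₁, h₂⟩
    refine ⟨⟨?_, ?_⟩, ?_, ?_⟩ <;> linarith
end

section
/- Let G = (V, E) be a finite simple graph, w : V → ℝ a positive weight function, and T > 0 a threshold such that distinct vertices u, v are adjacent if and only if w(u) + w(v) ≥ T and |w(u) − w(v)| ≤ T, and let I = {v ∈ V : w(v) < T/2}. Then the open neighborhood N(I) of I is a clique of G. -/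
/-- In a paired threshold graph realized by `w` and `T`, with
`I = {v : w v < T/2}`, the open neighborhood `N(I)` is a clique. -/
theorem open_neighborhood_of_light_vertices_clique {V : Type*} [Fintype V]
    (G : SimpleGraph V) (w : V → ℝ) (T : ℝ) (hw : ∀ v, 0 < w v) (hT : 0 < T)
    (hadj : ∀ u v, u ≠ v → (G.Adj u v ↔ T ≤ w u + w v ∧ |w u - w v| ≤ T)) :
    G.IsClique (openNbhd G {v | w v < T / 2}) := by
  have weight_bounds : ∀ u ∈ openNbhd G {v | w v < T / 2}, T / 2 ≤ w u ∧ w u < 3 * T / 2 := by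
    rintro u ⟨hu | ⟨x, hx, hxu⟩, hu'⟩
    · exact absurd hu hu'
    · rw [Set.mem_ofPred_eq] at hx hu'
      have hdiff := abs_le.mp ((hadj x u hxu.ne).mp hxu).2
      exact ⟨not_lt.mp hu', by linarith [hdiff.1]⟩
  intro u hu v hv huv
  obtain ⟨hu₁, hu₂⟩ := weight_bounds u hu
  obtain ⟨hv₁, hv₂⟩ := weight_bounds v hv
  exact (hadj u v huv).mpr ⟨by linarith, abs_le.mpr ⟨by linarith, by linarith⟩⟩
end

section
/- Let G = (V, E) be a finite simple graph, w : V → ℝ a positive weight function, and T > 0 a threshold such that distinct vertices u, v are adjacent if and only if w(u) + w(v) ≥ T and |w(u) − w(v)| ≤ T, and let I = {v ∈ V : w(v) < T/2}. Then for all x, y ∈ I with w(x) ≤ w(y), the neighborhood of x is contained in the neighborhood of y, i.e., N(x) ⊆ N(y). -/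
/-- In a paired threshold graph realized by `w` and `T`, with
`I = {v : w v < T/2}`, for `x, y ∈ I` with `w x ≤ w y` we have `N(x) ⊆ N(y)`. -/
theorem light_neighborhoods_nested {V : Type*} [Fintype V]
    (G : SimpleGraph V) (w : V → ℝ) (T : ℝ) (hw : ∀ v, 0 < w v) (hT : 0 < T)
    (hadj : ∀ u v, u ≠ v → (G.Adj u v ↔ T ≤ w u + w v ∧ |w u - w v| ≤ T)) :
    ∀ x ∈ {v | w v < T / 2}, ∀ y ∈ {v | w v < T / 2}, w x ≤ w y →
      G.neighborSet x ⊆ G.neighborSet y := by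
  intro x hx y hy hxy z hz
  simp only [Set.mem_ofPred_eq] at hx hy
  obtain ⟨hsum, hdiff⟩ := (hadj x z (G.ne_of_adj hz)).1 hz
  have hyz : w y < w z := by linarith
  refine (hadj y z (fun h => hyz.ne (congrArg w h))).2 ⟨by linarith, ?_⟩
  rw [abs_le] at hdiff ⊢
  constructor <;> linarith
end

section
/- Let G = (V, E) be a finite simple graph, w : V → ℝ a positive weight function, and T > 0 a threshold such that distinct vertices u, v are adjacent if and only if w(u) + w(v) ≥ T and |w(u) − w(v)| ≤ T, and let I = {v ∈ V : w(v) < T/2}. Then the subgraph of G induced by the closed neighborhood N[I] is a threshold graph. -/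
/-- A vertex in the closed neighborhood of the light vertices has weight less than `3T/2`. -/
theorem weight_lt_of_mem_closedNbhd_light {V : Type*} (G : SimpleGraph V) (w : V → ℝ) (T : ℝ)
    (hT : 0 < T) (hadj : ∀ u v, u ≠ v → (G.Adj u v ↔ T ≤ w u + w v ∧ |w u - w v| ≤ T))
    {v : V} (hv : v ∈ closedNbhd G {v | w v < T / 2}) : w v < 3 * T / 2 := by
  rcases hv with hv | ⟨x, hx, hxv⟩
  · have hv : w v < T / 2 := hv
    linarith
  · have hx : w x < T / 2 := hx
    have := (abs_le.1 ((hadj x v hxv.ne).1 hxv).2).1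
    linarith

/-- In a paired threshold graph realized by `w` and `T`, with
`I = {v : w v < T/2}`, the subgraph induced by `N[I]` is a threshold graph. -/
theorem closed_neighborhood_of_light_vertices_threshold {V : Type*} [Fintype V]
    (G : SimpleGraph V) (w : V → ℝ) (T : ℝ) (hw : ∀ v, 0 < w v) (hT : 0 < T)
    (hadj : ∀ u v, u ≠ v → (G.Adj u v ↔ T ≤ w u + w v ∧ |w u - w v| ≤ T)) :
    IsThresholdGraph (G.induce (closedNbhd G {v | w v < T / 2})) := by
  have hlt : ∀ v : closedNbhd G {v | w v < T / 2}, w v < 3 * T / 2 := fun v =>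
    weight_lt_of_mem_closedNbhd_light G w T hT hadj v.2
  refine ⟨fun v => T - |w v - T|, T, fun v => ?_, hT, fun u v huv => ?_⟩
  · have : |w v - T| < T := abs_lt.2 ⟨by linarith [hw v], by linarith [hlt v]⟩
    linarith
  · rw [SimpleGraph.induce_adj, hadj u v (Subtype.coe_injective.ne huv), abs_le]
    have hu := hlt u
    have hv := hlt v
    have hu0 := hw u
    have hv0 := hw v
    rcases abs_cases (w u - T) with ⟨h₁, _⟩ | ⟨h₁, _⟩ <;>
      rcases abs_cases (w v - T) with ⟨h₂, _⟩ | ⟨h₂, _⟩ <;>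
      simp only [h₁, h₂] <;>
      exact ⟨fun ⟨_, _, _⟩ => by linarith, fun _ => ⟨by linarith, by linarith, by linarith⟩⟩
end

section
/- Let G = (V, E) be a finite simple graph on n vertices, w : V → ℝ a positive weight function, and T > 0 a threshold such that distinct vertices u, v are adjacent if and only if w(u) + w(v) ≥ T and |w(u) − w(v)| ≤ T. Then every ordering σ : V → {1, …, n} such that σ(u) < σ(v) implies w(u) ≤ w(v) is a broom ordering of G. -/
/-- In a paired threshold graph realized by `w` and `T`, any
ordering of the vertices by nondecreasing weight is a broom ordering. -/
theorem weight_ordering_is_broom {V : Type*} [Fintype V]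
    (G : SimpleGraph V) (w : V → ℝ) (T : ℝ) (hw : ∀ v, 0 < w v) (hT : 0 < T)
    (hadj : ∀ u v, u ≠ v → (G.Adj u v ↔ T ≤ w u + w v ∧ |w u - w v| ≤ T))
    (σ : V ≃ Fin (Fintype.card V)) (hσ : ∀ u v : V, σ u < σ v → w u ≤ w v) :
    IsBroomOrdering G σ := by
  have mono : ∀ u v : V, σ u ≤ σ v → w u ≤ w v := fun u v h => by
    rcases h.lt_or_eq with h | h
    · exact hσ u v h
    · rw [σ.injective h]
  have adj_iff : ∀ u v : V, σ u < σ v → (G.Adj u v ↔ T ≤ w u + w v ∧ w v - w u ≤ T) :=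
    fun u v h => by
      rw [hadj u v (fun e => by simp [e] at h), abs_sub_comm,
        abs_of_nonneg (sub_nonneg.2 (hσ u v h))]
  -- `p` is the number of vertices of weight less than `T / 2`.
  obtain ⟨p, hp, light, heavy⟩ : ∃ p ≤ Fintype.card V,
      (∀ u, (σ u : ℕ) < p → w u < T / 2) ∧ ∀ u, p ≤ (σ u : ℕ) → T / 2 ≤ w u := by
    classical
    have ex : ∃ p, ∀ u, p ≤ (σ u : ℕ) → T / 2 ≤ w u :=
      ⟨Fintype.card V, fun u h => absurd (σ u).isLt h.not_gt⟩
    refine ⟨Nat.find ex, Nat.find_min' ex fun u h => absurd (σ u).isLt h.not_gt,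
      fun u hu => ?_, Nat.find_spec ex⟩
    have hmin := Nat.find_min ex hu
    push Not at hmin
    obtain ⟨v, huv, hv⟩ := hmin
    exact (mono u v huv).trans_lt hv
  refine ⟨fun x y z hxy hyz hxz => ?_, p, hp, fun u hu => ?_, fun x y z hx hxy hyz hxz => ?_⟩
  · rw [adj_iff x z (hxy.trans hyz)] at hxz
    rw [adj_iff y z hyz]
    have := hσ x y hxy
    constructor <;> linarith
  · have hlight := light u hu
    have later : ∀ v, G.Adj u v → p ≤ (σ v : ℕ) := fun v huv => by
      by_contra! hv
      have := light v hv
      have := ((hadj u v huv.ne).1 huv).1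
      linarith
    refine ⟨later, ?_⟩
    rintro _ b _ ⟨x, hux, rfl⟩ ⟨z, huz, rfl⟩ hxb hbz
    obtain ⟨y, rfl⟩ := σ.surjective b
    have hx : σ u < σ x := Fin.lt_def.2 (hu.trans_le (later x hux))
    have hz : σ u < σ z := Fin.lt_def.2 (hu.trans_le (later z huz))
    rw [adj_iff u x hx] at hux
    rw [adj_iff u z hz] at huz
    refine ⟨y, (adj_iff u y (hx.trans_le hxb)).2 ?_, rfl⟩
    have := mono x y hxb
    have := mono y z hbz
    constructor <;> linarith
  · rw [adj_iff x z (hxy.trans hyz)] at hxz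
    rw [adj_iff x y hxy, adj_iff y z hyz]
    have := heavy x hx
    have := hσ x y hxy
    have := hσ y z hyz
    refine ⟨⟨?_, ?_⟩, ?_, ?_⟩ <;> linarith
end

section
/- A finite simple graph G is a paired threshold graph if and only if G admits a broom ordering. -/
/-- Sorting the vertices by a real weight gives an ordering along which the weight is monotone. -/
theorem exists_equiv_fin_monotone {V : Type*} [Fintype V] (w : V → ℝ) :
    ∃ σ : V ≃ Fin (Fintype.card V), ∀ u v, σ u ≤ σ v → w u ≤ w v := by
  let e := Fintype.equivFin V
  refine ⟨e.trans (Tuple.sort (w ∘ e.symm)).symm, fun u v h => ?_⟩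
  simpa using Tuple.monotone_sort (w ∘ e.symm) h

/-- Along a weight-monotone ordering, the vertices of weight less than `t` come first. -/
theorem exists_position_lt_iff_lt {V : Type*} [Fintype V] (σ : V ≃ Fin (Fintype.card V))
    (w : V → ℝ) (hw : ∀ u v, σ u ≤ σ v → w u ≤ w v) (t : ℝ) :
    ∃ p ≤ Fintype.card V, ∀ u, (σ u : ℕ) < p ↔ w u < t := by
  classical
  have hex : ∃ k, ∀ u, k ≤ (σ u : ℕ) → t ≤ w u :=
    ⟨Fintype.card V, fun u hu => absurd (σ u).isLt (not_lt.2 hu)⟩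
  refine ⟨Nat.find hex, Nat.find_min' hex fun u hu => absurd (σ u).isLt (not_lt.2 hu),
    fun u => ⟨fun hu => ?_, fun hu => ?_⟩⟩
  · have h := Nat.find_min hex hu
    push Not at h
    obtain ⟨v, hv, hlt⟩ := h
    exact (hw u v hv).trans_lt hlt
  · by_contra hn
    exact absurd (Nat.find_spec hex u (not_lt.1 hn)) (not_le.2 hu)

theorem IsPairedThresholdGraph.exists_isBroomOrdering {V : Type*} [Fintype V]
    {G : SimpleGraph V} (hG : IsPairedThresholdGraph G) :
    ∃ σ : V ≃ Fin (Fintype.card V), IsBroomOrdering G σ := by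
  obtain ⟨w, Tp, Tm, -, -, -, hadj⟩ := hG
  obtain ⟨σ, hσ⟩ := exists_equiv_fin_monotone w
  obtain ⟨p, hp, hpw⟩ := exists_position_lt_iff_lt σ w hσ (Tp / 2)
  have adj_of {u v : V} (h : σ u < σ v) (hs : Tp ≤ w u + w v) (hd : w v - w u ≤ Tm) :
      G.Adj u v := by
    refine (hadj u v fun e => h.ne (congrArg σ e)).2 ⟨hs, ?_⟩
    rw [abs_le]
    constructor <;> linarith [hσ u v h.le]
  have of_adj {u v : V} (h : G.Adj u v) : Tp ≤ w u + w v ∧ w v - w u ≤ Tm := by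
    obtain ⟨hs, hd⟩ := (hadj u v h.ne).1 h
    exact ⟨hs, by linarith [(abs_le.1 hd).1]⟩
  refine ⟨σ, fun x y z hxy hyz hxz => ?_, p, hp, fun u hu => ?_, fun x y z hx hxy hyz hxz => ?_⟩
  · have h := of_adj hxz
    have h1 := hσ x y hxy.le
    exact adj_of hyz (by linarith) (by linarith)
  · have hwu := (hpw u).1 hu
    have large (v : V) (h : G.Adj u v) : p ≤ (σ v : ℕ) := by
      by_contra hv
      linarith [(of_adj h).1, (hpw v).1 (not_le.1 hv)]
    refine ⟨large, ?_⟩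
    rintro _ b _ ⟨x, hx, rfl⟩ ⟨z, hz, rfl⟩ hab hbc
    obtain ⟨y, rfl⟩ := σ.surjective b
    have hxy := hσ x y hab
    have hyz := hσ y z hbc
    have huy : σ u < σ y := lt_of_lt_of_le (Fin.lt_def.2 (hu.trans_le (large x hx))) hab
    exact ⟨y, adj_of huy (by linarith [(of_adj hx).1]) (by linarith [(of_adj hz).2]), rfl⟩
  · have hwx : Tp / 2 ≤ w x := not_lt.1 fun h => absurd ((hpw x).2 h) (not_lt.2 hx)
    have h := of_adj hxz
    have h1 := hσ x y hxy.le
    have h2 := hσ y z hyz.le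
    exact ⟨adj_of hxy (by linarith) (by linarith), adj_of hyz (by linarith) (by linarith)⟩

/-- Real positions of an initial clique `p, …, c` spread over less than `T` extend to a strict
unit-interval representation (with unit `T`) of any umbrella ordering of `p, …, N - 1`. -/
theorem exists_extension_of_umbrella {A : ℕ → ℕ → Prop} {p c : ℕ} {T : ℝ} (hT : 0 < T)
    (hA : ∀ x y z, p ≤ x → x < y → y < z → A x z → A x y ∧ A y z)
    (hK : ∀ i j, p ≤ i → i < j → j ≤ c → A i j) (g : ℕ → ℝ)
    (hg : ∀ i j, p ≤ i → i < j → j ≤ c → g i < g j ∧ g j - g i < T) (N : ℕ) :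
    ∃ x : ℕ → ℝ, (∀ k ≤ c, x k = g k) ∧
      ∀ i j, p ≤ i → i < j → j < N →
        x i < x j ∧ (A i j → x j - x i < T) ∧ (¬ A i j → T < x j - x i) := by
  classical
  induction N with
  | zero => exact ⟨g, fun _ _ => rfl, fun i j _ _ h => absurd h (Nat.not_lt_zero j)⟩
  | succ N ih =>
    obtain ⟨x, hxg, hx⟩ := ih
    rcases le_or_gt N c with hN | hN
    · refine ⟨g, fun _ _ => rfl, fun i j hi hij hj => ?_⟩
      have hjc : j ≤ c := by omega
      exact ⟨(hg i j hi hij hjc).1, fun _ => (hg i j hi hij hjc).2,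
        fun h => absurd (hK i j hi hij hjc) h⟩
    · let I := Finset.Ico p N
      obtain ⟨t, hlo, hhi⟩ := Order.exists_between_finsets
        (I.image x ∪ (I.filter fun i => ¬ A i N).image fun i => x i + T)
        ((I.filter fun i => A i N).image fun i => x i + T) (by
          intro a ha b hb
          simp only [I, Finset.mem_union, Finset.mem_image, Finset.mem_filter,
            Finset.mem_Ico] at ha hb
          obtain ⟨j, ⟨⟨hpj, hjN⟩, hAj⟩, rfl⟩ := hb
          rcases ha with ⟨i, ⟨hpi, hiN⟩, rfl⟩ | ⟨i, ⟨⟨hpi, hiN⟩, hAi⟩, rfl⟩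
          · rcases lt_trichotomy i j with h | rfl | h
            · linarith [(hx i j hpi h hjN).1]
            · linarith
            · linarith [(hx j i hpj h hiN).2.1 (hA j i N hpj h hiN hAj).1]
          · rcases lt_trichotomy i j with h | rfl | h
            · linarith [(hx i j hpi h hjN).1]
            · exact absurd hAj hAi
            · exact absurd (hA j i N hpj h hiN hAj).2 hAi)
      refine ⟨Function.update x N t, fun k hk => ?_, fun i j hi hij hj => ?_⟩
      · rw [Function.update_of_ne (by omega), hxg k hk]
      · rw [Function.update_of_ne (by omega : i ≠ N)]
        rcases (Nat.lt_succ_iff.1 hj).lt_or_eq with h | rfl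
        · rw [Function.update_of_ne h.ne]
          exact hx i j hi hij h
        · rw [Function.update_self]
          have hmem : i ∈ I := Finset.mem_Ico.2 ⟨hi, hij⟩
          refine ⟨hlo _ (Finset.mem_union_left _ (Finset.mem_image_of_mem _ hmem)),
            fun h => ?_, fun h => ?_⟩
          · linarith [hhi _ (Finset.mem_image_of_mem (fun i => x i + T)
              (Finset.mem_filter.2 ⟨hmem, h⟩))]
          · linarith [hlo _ (Finset.mem_union_right _ (Finset.mem_image_of_mem
              (fun i => x i + T) (Finset.mem_filter.2 ⟨hmem, h⟩)))]

/-- Weights realising a broom ordering on positions `0, …, n - 1`, normalised so that the sum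
threshold is `0`. -/
theorem exists_weights_of_broom {A : ℕ → ℕ → Prop} {n p : ℕ} (hpn : p ≤ n)
    (hlt : ∀ i j, A i j → j < n)
    (hinterval : ∀ i j k, i < j → j < k → A i k → A j k)
    (hindep : ∀ i j, i < p → A i j → p ≤ j)
    (hconsec : ∀ i a b c, i < p → A i a → A i c → a ≤ b → b ≤ c → A i b)
    (humbrella : ∀ x y z, p ≤ x → x < y → y < z → A x z → A x y ∧ A y z) :
    ∃ (x : ℕ → ℝ) (L : ℝ), 0 < L ∧ (∀ i < n, -L ≤ x i) ∧
      ∀ i j, i < j → j < n → (A i j ↔ 0 ≤ x i + x j ∧ |x i - x j| ≤ 2 * L) := by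
  classical
  -- `c` is the last position of the closed neighbourhood of `p` within `p, …, n - 1`.
  obtain ⟨c, hpc, hcn, hc⟩ : ∃ c, p ≤ c ∧ c ≤ n ∧ ∀ k, p < k → (A p k ↔ k ≤ c) := by
    have hspec := Nat.findGreatest_spec (P := fun k => k = p ∨ A p k) hpn (Or.inl rfl)
    refine ⟨Nat.findGreatest (fun k => k = p ∨ A p k) n, Nat.le_findGreatest hpn (Or.inl rfl),
      Nat.findGreatest_le n, fun k hk => ⟨fun h => Nat.le_findGreatest (hlt p k h).le (Or.inr h),
      fun h => ?_⟩⟩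
    rcases hspec with h' | h'
    · omega
    · rcases h.lt_or_eq with hl | he
      · exact (humbrella p k _ le_rfl hk hl h').1
      · rwa [he]
  have hK (i j : ℕ) (hi : p ≤ i) (hij : i < j) (hj : j ≤ c) : A i j := by
    have hpj : A p j := (hc j (by omega)).2 hj
    rcases hi.lt_or_eq with h | rfl
    · exact (humbrella p i j le_rfl h hij hpj).2
    · exact hpj
  -- `e k` is the first position before `p` adjacent to `k`, or `p` if there is none.
  have he (k : ℕ) : ∃ e ≤ p, p ≤ k → ∀ i < p, (A i k ↔ e ≤ i) := by
    have hex : ∃ i, i = p ∨ A i k := ⟨p, Or.inl rfl⟩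
    refine ⟨Nat.find hex, Nat.find_min' hex (Or.inl rfl), fun hk i hi =>
      ⟨fun h => Nat.find_min' hex (Or.inr h), fun h => ?_⟩⟩
    rcases Nat.find_spec hex with h' | h'
    · omega
    · rcases h.lt_or_eq with hl | he
      · exact hinterval _ i k hl (by omega) h'
      · rwa [← he]
  choose e hep he using he
  obtain ⟨m, hm, hmin⟩ := Finset.exists_min_image (Finset.Icc p c) e ⟨p, by simp [hpc]⟩
  obtain ⟨hpm, hmc⟩ := Finset.mem_Icc.1 hm
  have hmin' (k : ℕ) (h1 : p ≤ k) (h2 : k ≤ c) : e m ≤ e k := hmin k (Finset.mem_Icc.2 ⟨h1, h2⟩)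
  have he_left (i j : ℕ) (hi : p ≤ i) (hij : i < j) (hj : j ≤ m) : e j ≤ e i := by
    rcases (hep i).lt_or_eq with h | h
    · exact (he j (by omega) _ h).1 (hconsec _ i j m h ((he i hi _ h).2 le_rfl)
        ((he m hpm _ h).2 (hmin' i hi (by omega))) hij.le hj)
    · exact h ▸ hep j
  have he_right (i j : ℕ) (hi : m ≤ i) (hij : i < j) (hj : j ≤ c) : e i ≤ e j := by
    rcases (hep j).lt_or_eq with h | h
    · exact (he i (by omega) _ h).1 (hconsec _ m i j h
        ((he m hpm _ h).2 (hmin' j (by omega) hj)) ((he j (by omega) _ h).2 le_rfl) hi hij.le)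
    · exact h ▸ hep i
  -- Signed offsets of `p, …, c` from the centre; the layers are given by `e`.
  let f : ℕ → ℤ := fun k =>
    if k ≤ m then -((e k : ℤ) * (n + 1) + (m - k)) else (e k : ℤ) * (n + 1) + (k - m)
  let L : ℤ := (n + 2) ^ 2
  have hf_layer (k : ℕ) (hk : p ≤ k) (hkc : k ≤ c) (i : ℕ) :
      e k ≤ i ↔ |f k| ≤ i * (n + 1) + n := by
    have habs : |f k| = e k * (n + 1) + |(k : ℤ) - m| := by
      have h0 : (0 : ℤ) ≤ e k * (n + 1) := by positivity
      simp only [f]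
      split_ifs with hkm
      · rw [abs_neg, abs_of_nonneg (by omega), abs_of_nonpos (by omega)]
        ring
      · rw [abs_of_nonneg (by omega), abs_of_nonneg (by omega)]
    have hd : |(k : ℤ) - m| ≤ n := abs_le.2 ⟨by omega, by omega⟩
    rw [habs]
    constructor
    · intro hle
      have : (e k : ℤ) ≤ i := by exact_mod_cast hle
      nlinarith
    · intro hle
      by_contra hlt'
      have : (i : ℤ) + 1 ≤ e k := by exact_mod_cast not_le.1 hlt'
      nlinarith [abs_nonneg ((k : ℤ) - m)]
  have hf_bound (k : ℕ) (hk : p ≤ k) (hkc : k ≤ c) : |f k| < L := by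
    have h := (hf_layer k hk hkc p).1 (hep k)
    have : (p : ℤ) ≤ n := by exact_mod_cast hpn
    simp only [L]
    nlinarith
  have hf_mono (i j : ℕ) (hi : p ≤ i) (hij : i < j) (hj : j ≤ c) : f i < f j := by
    have hmul {a b : ℕ} (hab : a ≤ b) : (a : ℤ) * (n + 1) ≤ b * (n + 1) := by
      exact_mod_cast Nat.mul_le_mul_right _ hab
    have h0 (k : ℕ) : (0 : ℤ) ≤ e k * (n + 1) := by positivity
    have hi0 := h0 i
    have hj0 := h0 j
    simp only [f]
    split_ifs with him hjm hjm
    · have := hmul (he_left i j hi hij hjm)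
      omega
    · omega
    · omega
    · have := hmul (he_right i j (by omega) hij hj)
      omega
  have hLpos : (0 : ℝ) < L := by simp only [L]; positivity
  obtain ⟨x, hxg, hx⟩ := exists_extension_of_umbrella (T := 2 * L) (by linarith) humbrella hK
    (fun k => (L : ℝ) + f k) (fun i j hi hij hj => by
      have h1 := hf_mono i j hi hij hj
      have h2 := abs_lt.1 (hf_bound i hi (by omega))
      have h3 := abs_lt.1 (hf_bound j (by omega) hj)
      constructor
      · have : (f i : ℝ) < f j := by exact_mod_cast h1
        linarith
      · have h4 : (-L : ℝ) < f i := by exact_mod_cast h2.1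
        have h5 : (f j : ℝ) < L := by exact_mod_cast h3.2
        linarith) n
  have hfp : (-L : ℝ) < f p := by exact_mod_cast (abs_lt.1 (hf_bound p le_rfl hpc)).1
  have hxp (k : ℕ) (hk : p ≤ k) (hkn : k < n) : 0 < x k := by
    have h0 : x p = L + f p := hxg p hpc
    rcases hk.lt_or_eq with h | rfl
    · linarith [(hx p k le_rfl h hkn).1]
    · linarith
  let h : ℕ → ℝ := fun i => i * (n + 1) + n
  have hh (i : ℕ) (hi : i < p) : 0 ≤ h i ∧ h i < L := by
    refine ⟨by positivity, ?_⟩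
    have : (i : ℝ) < n := by exact_mod_cast hi.trans_le hpn
    simp only [h, L]
    push_cast
    nlinarith
  refine ⟨fun i => if i < p then -(L - h i) else x i, L, hLpos, fun i hi => ?_,
    fun i j hij hj => ?_⟩
  · dsimp only
    split_ifs with hip
    · linarith [hh i hip]
    · linarith [hxp i (not_lt.1 hip) hi]
  · dsimp only
    rcases lt_or_ge i p with hip | hip
    · have hhi := hh i hip
      rw [if_pos hip]
      rcases lt_or_ge j p with hjp | hjp
      · rw [if_pos hjp]
        refine ⟨fun hA => absurd (hindep i j hip hA) (not_le.2 hjp), fun hs => ?_⟩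
        linarith [hs.1, hh j hjp]
      · rw [if_neg (not_lt.2 hjp)]
        rcases le_or_gt j c with hjc | hjc
        · rw [he j hjp i hip, hf_layer j hjp hjc i, hxg j hjc]
          have hcast : |f j| ≤ i * (n + 1) + n ↔ |(f j : ℝ)| ≤ h i := by
            simp only [h]; exact_mod_cast Iff.rfl
          rw [hcast, abs_le, abs_le]
          constructor
          · rintro ⟨h1, h2⟩
            refine ⟨?_, ?_, ?_⟩ <;> linarith
          · rintro ⟨h1, h2, h3⟩
            constructor <;> linarith
        · have hnA : ¬ A p j := fun hA => absurd ((hc j (by omega)).1 hA) (not_le.2 hjc)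
          have h1 := (hx p j le_rfl (by omega) hj).2.2 hnA
          have h0 : x p = L + f p := hxg p hpc
          refine ⟨fun hA => absurd (hinterval i p j hip (by omega) hA) hnA, fun hs => ?_⟩
          linarith [(abs_le.1 hs.2).1]
    · have hjp : p ≤ j := hip.trans hij.le
      rw [if_neg (not_lt.2 hip), if_neg (not_lt.2 hjp)]
      obtain ⟨h1, h2, h3⟩ := hx i j hip hij hj
      have hi0 := hxp i hip (hij.trans hj)
      have hj0 := hxp j hjp hj
      refine ⟨fun hA => ⟨by linarith, abs_le.2 ⟨by linarith [h2 hA], by linarith⟩⟩, fun hs => ?_⟩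
      by_contra hA
      linarith [h3 hA, (abs_le.1 hs.2).1]

theorem IsBroomOrdering.isPairedThresholdGraph {V : Type*} [Fintype V] {G : SimpleGraph V}
    {σ : V ≃ Fin (Fintype.card V)} (hσ : IsBroomOrdering G σ) : IsPairedThresholdGraph G := by
  obtain ⟨hint, p, hpn, hI, hU⟩ := hσ
  let A : ℕ → ℕ → Prop := fun i j => ∃ u v, G.Adj u v ∧ (σ u : ℕ) = i ∧ (σ v : ℕ) = j
  have hA (u v : V) : A (σ u) (σ v) ↔ G.Adj u v := by
    refine ⟨?_, fun h => ⟨u, v, h, rfl, rfl⟩⟩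
    rintro ⟨u', v', h, hu, hv⟩
    rwa [← σ.injective (Fin.ext hu), ← σ.injective (Fin.ext hv)]
  have hbetween {j : ℕ} (z : V) (h : j ≤ (σ z : ℕ)) : ∃ y, (σ y : ℕ) = j :=
    ⟨σ.symm ⟨j, h.trans_lt (σ z).isLt⟩, by simp⟩
  obtain ⟨x, L, hL, hxL, hx⟩ := exists_weights_of_broom (A := A) hpn
    (by rintro i j ⟨u, v, -, -, rfl⟩; exact (σ v).isLt)
    (by
      rintro _ j _ hij hjk ⟨u, v, h, rfl, rfl⟩
      obtain ⟨y, rfl⟩ := hbetween v hjk.le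
      exact (hA y v).2 (hint u y v hij hjk h))
    (by rintro _ _ hi ⟨u, v, h, rfl, rfl⟩; exact (hI u hi).1 v h)
    (by
      rintro _ _ b _ hi ⟨u, v, h, rfl, rfl⟩ ⟨u', v', h', hu, rfl⟩ hab hbc
      obtain ⟨y, rfl⟩ := hbetween v' hbc
      obtain rfl := σ.injective (Fin.ext hu)
      obtain ⟨y', hy', hyy⟩ := (hI u' hi).2 (σ v) (σ y) (σ v') ⟨v, h, rfl⟩ ⟨v', h', rfl⟩ hab hbc
      exact ⟨u', y', hy', rfl, congrArg Fin.val hyy⟩)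
    (by
      rintro _ j _ hp hij hjk ⟨u, v, h, rfl, rfl⟩
      obtain ⟨y, rfl⟩ := hbetween v hjk.le
      rw [hA, hA]
      exact hU u y v hp hij hjk h)
  have key (u v : V) (huv : σ u < σ v) :
      G.Adj u v ↔ 4 * L ≤ (x (σ u) + 2 * L) + (x (σ v) + 2 * L) ∧
        |(x (σ u) + 2 * L) - (x (σ v) + 2 * L)| ≤ 2 * L := by
    rw [← hA, hx _ _ huv (σ v).isLt, add_sub_add_right_eq_sub]
    exact and_congr_left fun _ => ⟨fun h => by linarith, fun h => by linarith⟩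
  refine ⟨fun v => x (σ v) + 2 * L, 4 * L, 2 * L, fun v => ?_, by linarith, by linarith,
    fun u v huv => ?_⟩
  · linarith [hxL (σ v) (σ v).isLt]
  · rcases lt_or_gt_of_ne fun h => huv (σ.injective h) with h | h
    · exact key u v h
    · rw [G.adj_comm, abs_sub_comm, add_comm (x (σ u) + 2 * L)]
      exact key v u h

/-- `G` is a paired threshold graph iff it admits a broom
ordering. -/
theorem paired_threshold_iff_broom_ordering {V : Type*} [Fintype V] (G : SimpleGraph V) :
    IsPairedThresholdGraph G ↔ ∃ σ : V ≃ Fin (Fintype.card V), IsBroomOrdering G σ := by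
  exact ⟨IsPairedThresholdGraph.exists_isBroomOrdering, fun ⟨_, hσ⟩ => hσ.isPairedThresholdGraph⟩
end

section
/- A finite simple graph G is a paired threshold graph if and only if G has a paired threshold partition. -/
open Finset in
/-- A nested family of convex subsets of `{0, …, m - 1}` can be realized by balls
centered at the origin, after placing the indices on the line in increasing order. -/
theorem exists_strictMono_ball_representation {ι : Type*} [Fintype ι] (P : ι → ℕ → Prop) (m : ℕ)
    (hconv : ∀ v a b c, P v a → P v c → a ≤ b → b ≤ c → P v b)
    (hlt : ∀ v a, P v a → a < m)
    (hnest : ∀ v v', (∀ i, P v i → P v' i) ∨ (∀ i, P v' i → P v i)) :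
    ∃ (f : ℕ → ℤ) (R : ι → ℤ) (B : ℤ),
      (∀ i j, i < j → j < m → f i < f j) ∧ (∀ i, i < m → |f i| ≤ B) ∧
      (∀ v, 0 ≤ R v ∧ R v ≤ B) ∧ ∀ v i, i < m → (P v i ↔ |f i| ≤ R v) := by
  classical
  let d : ℕ → ℕ := fun i => #{v | P v i}
  let e : ι → ℕ := fun v => #{v' | ∀ i, P v i → P v' i}
  have hdM : ∀ i, d i ≤ Fintype.card ι := fun i => card_le_univ _
  have heM : ∀ v, e v ≤ Fintype.card ι := fun i => card_le_univ _
  have hin : ∀ v i, P v i → e v ≤ d i := fun v i h =>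
    card_le_card fun v' hv' => by
      simp only [mem_filter, mem_univ, true_and] at hv' ⊢
      exact hv' i h
  have hout : ∀ v i, ¬ P v i → d i < e v := fun v i h => by
    refine card_lt_card ⟨fun v' hv' => ?_, fun hsub => ?_⟩
    · simp only [mem_filter, mem_univ, true_and] at hv' ⊢
      rcases hnest v v' with h' | h'
      · exact h'
      · exact absurd (h' i hv') h
    · have : v ∈ ({v' | P v' i} : Finset ι) := hsub (by simp)
      exact h (by simpa using this)
  obtain ⟨p, hpm, hp⟩ : ∃ p, (p < m ∨ m = 0) ∧ ∀ i, i < m → d i ≤ d p := by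
    rcases Nat.eq_zero_or_pos m with rfl | hm
    · exact ⟨0, Or.inr rfl, fun i hi => absurd hi (Nat.not_lt_zero i)⟩
    · obtain ⟨p, hp, h⟩ := exists_max_image (range m) d ⟨0, by simpa using hm⟩
      exact ⟨p, Or.inl (by simpa using hp), fun i hi => h i (by simpa using hi)⟩
  have hPp : ∀ v i, P v i → P v p := fun v i h => by
    by_contra hc
    have := hout v p hc
    have := hin v i h
    have := hp i (hlt v i h)
    omega
  have hleft : ∀ i j, i ≤ j → j ≤ p → d i ≤ d j := fun i j hij hj =>
    card_le_card fun v hv => by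
      simp only [mem_filter, mem_univ, true_and] at hv ⊢
      exact hconv v i j p hv (hPp v i hv) hij hj
  have hright : ∀ i j, i ≤ j → p ≤ i → d j ≤ d i := fun i j hij hi =>
    card_le_card fun v hv => by
      simp only [mem_filter, mem_univ, true_and] at hv ⊢
      exact hconv v p i j (hPp v j hv) hv hi hij
  let N : ℤ := m + 1
  let M : ℤ := Fintype.card ι
  have hN : 0 < N := by positivity
  let f : ℕ → ℤ := fun i =>
    if i < p then -(N * (M - d i)) + ((i : ℤ) - p) else N * (M - d i) + ((i : ℤ) - p)
  have hnn : ∀ i, 0 ≤ N * (M - d i) := fun i =>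
    mul_nonneg hN.le (sub_nonneg.2 (Int.ofNat_le.2 (hdM i)))
  have habs : ∀ i, |f i| = N * (M - d i) + |(i : ℤ) - p| := fun i => by
    have := hnn i
    by_cases h : i < p
    · simp only [f, if_pos h]
      rw [abs_of_nonpos (by omega), abs_of_nonpos (by omega)]
      ring
    · simp only [f, if_neg h]
      rw [abs_of_nonneg (by omega), abs_of_nonneg (by omega)]
  have hdist : ∀ i, i < m → |(i : ℤ) - p| ≤ N - 1 := fun i hi => by
    simp only [N]
    rw [abs_le]
    omega
  refine ⟨f, fun v => N * (M - e v) + N - 1, N * M + N, fun i j hij hj => ?_, fun i hi => ?_,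
    fun v => ⟨?_, ?_⟩, fun v i hi => ⟨fun h => ?_, fun h => ?_⟩⟩
  · have h1 := hnn i
    have h2 := hnn j
    by_cases hjp : j < p
    · have h3 : N * (M - d j) ≤ N * (M - d i) :=
        mul_le_mul_of_nonneg_left (by have := hleft i j hij.le hjp.le; omega) hN.le
      simp only [f, if_pos hjp, if_pos (hij.trans hjp)]
      omega
    · by_cases hip : i < p
      · simp only [f, if_neg hjp, if_pos hip]
        omega
      · have h3 : N * (M - d i) ≤ N * (M - d j) :=
          mul_le_mul_of_nonneg_left (by have := hright i j hij.le (by omega); omega) hN.le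
        simp only [f, if_neg hjp, if_neg hip]
        omega
  · rw [habs]
    have := hdist i hi
    have : 0 ≤ N * (d i : ℤ) := by positivity
    linarith [mul_sub N M (d i : ℤ)]
  · have : 0 ≤ N * (M - e v) :=
      mul_nonneg hN.le (sub_nonneg.2 (Int.ofNat_le.2 (heM v)))
    simp only
    omega
  · have : 0 ≤ N * (e v : ℤ) := by positivity
    linarith [mul_sub N M (e v : ℤ)]
  · have h1 : N * (M - d i) ≤ N * (M - e v) :=
      mul_le_mul_of_nonneg_left (by have := hin v i h; omega) hN.le
    rw [habs]
    linarith [hdist i hi]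
  · by_contra hc
    have h1 : N * (M - e v + 1) ≤ N * (M - d i) :=
      mul_le_mul_of_nonneg_left (by have := hout v i hc; omega) hN.le
    rw [habs] at h
    linarith [abs_nonneg ((i : ℤ) - p), mul_add N (M - e v) 1]

/-- A representation of the closed neighborhood of the first vertex of an umbrella ordering
extends to a representation in which adjacency means distance less than `T` and
non-adjacency means distance greater than `T`. -/
theorem exists_extend_umbrella_representation (A : ℕ → ℕ → Prop)
    (hA : ∀ i j l, i < j → j < l → A i l → A i j ∧ A j l)
    (f : ℕ → ℝ) (T : ℝ) (hT : 0 < T)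
    (hmono : ∀ i j, i < j → (j = 0 ∨ A 0 j) → f i < f j)
    (hdiff : ∀ i j, i < j → (j = 0 ∨ A 0 j) → f j - f i < T) (n : ℕ) :
    ∃ w : ℕ → ℝ, (∀ i, i < n → (i = 0 ∨ A 0 i) → w i = f i) ∧
      ∀ i j, i < j → j < n →
        w i < w j ∧ (A i j → w j - w i < T) ∧ (¬ A i j → T < w j - w i) := by
  classical
  induction n with
  | zero => exact ⟨f, fun i hi => by omega, fun i j _ hj => by omega⟩
  | succ n ih =>
    obtain ⟨w, hwf, hw⟩ := ih
    suffices h : ∃ t : ℝ, ((n = 0 ∨ A 0 n) → t = f n) ∧ ∀ i, i < n →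
        w i < t ∧ (A i n → t - w i < T) ∧ (¬ A i n → T < t - w i) by
      obtain ⟨t, htf, ht⟩ := h
      refine ⟨Function.update w n t, fun i hi hS => ?_, fun i j hij hj => ?_⟩
      · rcases Nat.lt_succ_iff_lt_or_eq.1 hi with h | rfl
        · rw [Function.update_of_ne h.ne]
          exact hwf i h hS
        · rw [Function.update_self]
          exact htf hS
      · rcases Nat.lt_succ_iff_lt_or_eq.1 hj with h | rfl
        · rw [Function.update_of_ne h.ne, Function.update_of_ne (hij.trans h).ne]
          exact hw i j hij h
        · rw [Function.update_self, Function.update_of_ne hij.ne]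
          exact ht i hij
    by_cases hS : n = 0 ∨ A 0 n
    · refine ⟨f n, fun _ => rfl, fun i hi => ?_⟩
      have h0 : A 0 n := hS.resolve_left (by omega)
      have hi0 : i = 0 ∨ A 0 i := by
        rcases Nat.eq_zero_or_pos i with h | h
        · exact Or.inl h
        · exact Or.inr (hA 0 i n h hi h0).1
      have hin : A i n := by
        rcases Nat.eq_zero_or_pos i with rfl | h
        · exact h0
        · exact (hA 0 i n h hi h0).2
      rw [hwf i hi hi0]
      exact ⟨hmono i n hi hS, fun _ => hdiff i n hi hS, fun h => absurd hin h⟩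
    · obtain ⟨t, hlo, hhi⟩ := Order.exists_between_finsets
        ((Finset.range n).image w ∪
          ((Finset.range n).filter fun i => ¬ A i n).image fun i => w i + T)
        (((Finset.range n).filter fun i => A i n).image fun i => w i + T) (by
          intro x hx y hy
          simp only [Finset.mem_union, Finset.mem_image, Finset.mem_filter,
            Finset.mem_range] at hx hy
          obtain ⟨j, ⟨hj, hjA⟩, rfl⟩ := hy
          rcases hx with ⟨i, hi, rfl⟩ | ⟨i, ⟨hi, hiA⟩, rfl⟩
          · rcases lt_trichotomy i j with h | rfl | h
            · linarith [(hw i j h hj).1]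
            · linarith
            · linarith [(hw j i h hi).2.1 (hA j i n h hi hjA).1]
          · rcases lt_trichotomy i j with h | rfl | h
            · linarith [(hw i j h hj).1]
            · exact absurd hjA hiA
            · exact absurd (hA j i n h hi hjA).2 hiA)
      simp only [Finset.mem_union, Finset.mem_image, Finset.mem_filter,
        Finset.mem_range] at hlo hhi
      refine ⟨t, fun h => absurd h hS, fun i hi => ⟨?_, fun h => ?_, fun h => ?_⟩⟩
      · exact hlo _ (Or.inl ⟨i, hi, rfl⟩)
      · linarith [hhi _ ⟨i, ⟨hi, h⟩, rfl⟩]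
      · linarith [hlo _ (Or.inr ⟨i, ⟨hi, h⟩, rfl⟩)]

/-- A real-valued function on a finite type can be sorted. -/
theorem exists_equivFin_sorted {W : Type*} [Finite W] (w : W → ℝ) :
    ∃ σ : W ≃ Fin (Nat.card W), ∀ x y, σ x ≤ σ y → w x ≤ w y := by
  let e := Finite.equivFin W
  let s := Tuple.sort (w ∘ e.symm)
  refine ⟨e.trans s.symm, fun x y h => ?_⟩
  simpa [s] using Tuple.monotone_sort (w ∘ e.symm) h

theorem IsPairedThresholdGraph.exists_partition {V : Type*} [Finite V] {G : SimpleGraph V}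
    (h : IsPairedThresholdGraph G) : ∃ I U : Set V, IsPairedThresholdPartition G I U := by
  classical
  obtain ⟨w, Tp, Tm, hw, hTp, hTm, hG⟩ := h
  have hadj : ∀ u v, G.Adj u v → Tp ≤ w u + w v ∧ w u - w v ≤ Tm ∧ w v - w u ≤ Tm :=
    fun u v h => by
      obtain ⟨h1, h2⟩ := (hG u v h.ne).1 h
      rw [abs_le] at h2
      exact ⟨h1, h2.2, by linarith⟩
  have hadj' : ∀ u v, u ≠ v → Tp ≤ w u + w v → w u - w v ≤ Tm → w v - w u ≤ Tm → G.Adj u v :=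
    fun u v hne h1 h2 h3 => (hG u v hne).2 ⟨h1, abs_le.2 ⟨by linarith, h2⟩⟩
  have hnb : ∀ x, x ∈ closedNbhd G {v | w v < Tp / 2} → ¬ w x < Tp / 2 →
      ∃ v, w v < Tp / 2 ∧ G.Adj v x := by
    rintro x (hx | ⟨v, hv, hvx⟩) hx'
    · exact absurd hx hx'
    · exact ⟨v, hv, hvx⟩
  refine ⟨{v | w v < Tp / 2}, {v | Tp / 2 ≤ w v}, ?_, ?_, ?_, ?_, ?_, ?_⟩
  · ext v
    simpa using lt_or_ge (w v) (Tp / 2)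
  · rw [Set.disjoint_left]
    intro v hv hv'
    have h1 : w v < Tp / 2 := hv
    have h2 : Tp / 2 ≤ w v := hv'
    linarith
  · intro x hx y hy hxy
    have hx' : w x < Tp / 2 := hx
    have hy' : w y < Tp / 2 := hy
    linarith [(hadj x y hxy).1]
  · refine ⟨fun v => w v / Tm, fun u v huv => ?_⟩
    have hu : Tp / 2 ≤ w u := u.2
    have hv : Tp / 2 ≤ w v := v.2
    have hne : (u : V) ≠ v := fun h => huv (Subtype.ext h)
    have e1 : ∀ x : V, w x / Tm + 1 = (w x + Tm) / Tm := fun x => by field_simp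
    rw [SimpleGraph.comap_adj, Function.Embedding.subtype_apply, Function.Embedding.subtype_apply,
      Set.Icc_inter_Icc, Set.nonempty_Icc]
    simp only [sup_le_iff, le_inf_iff, e1, div_le_div_iff_of_pos_right hTm]
    constructor
    · intro h
      obtain ⟨_, h2, h3⟩ := hadj u v h
      exact ⟨⟨by linarith, by linarith⟩, by linarith, by linarith⟩
    · rintro ⟨⟨_, h2⟩, h3, _⟩
      exact hadj' u v hne (by linarith) (by linarith) (by linarith)
  · let g : V → ℝ := fun x =>
      if w x < Tp / 2 then w x else Tp - max (Tp - w x) (w x - Tm)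
    have hgI : ∀ x, w x < Tp / 2 → g x = w x := fun x hx => if_pos hx
    have hgU : ∀ x, ¬ w x < Tp / 2 → g x = Tp - max (Tp - w x) (w x - Tm) :=
      fun x hx => if_neg hx
    have hgbig : ∀ x, x ∈ closedNbhd G {v | w v < Tp / 2} → ¬ w x < Tp / 2 → Tp / 2 < g x := by
      intro x hx hx'
      obtain ⟨v, hv, hvx⟩ := hnb x hx hx'
      obtain ⟨h1, _, h3⟩ := hadj v x hvx
      have : max (Tp - w x) (w x - Tm) ≤ w v := max_le (by linarith) (by linarith)
      rw [hgU x hx']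
      linarith
    have hcross : ∀ u v, w u < Tp / 2 → ¬ w v < Tp / 2 → (G.Adj u v ↔ Tp ≤ g u + g v) := by
      intro u v hu hv
      have hne : u ≠ v := fun h => hv (h ▸ hu)
      rw [hgI u hu, hgU v hv]
      have e2 : Tp ≤ w u + (Tp - max (Tp - w v) (w v - Tm)) ↔
          max (Tp - w v) (w v - Tm) ≤ w u := by
        constructor <;> intro h <;> linarith
      rw [e2, max_le_iff]
      constructor
      · intro h
        obtain ⟨h1, _, h3⟩ := hadj u v h
        exact ⟨by linarith, by linarith⟩
      · rintro ⟨h1, h2⟩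
        exact hadj' u v hne (by linarith) (by linarith) (by linarith)
    refine ⟨fun x => g x, Tp, fun x => ?_, hTp, fun u v huv => ?_⟩
    · by_cases hx : w x < Tp / 2
      · simpa only [hgI x hx] using hw x
      · linarith [hgbig x x.2 hx]
    · have hne : (u : V) ≠ v := fun h => huv (Subtype.ext h)
      change G.Adj u v ↔ Tp ≤ g u + g v
      by_cases hu : w u < Tp / 2 <;> by_cases hv : w v < Tp / 2
      · rw [hgI u hu, hgI v hv]
        constructor
        · intro h
          linarith [(hadj u v h).1]
        · intro h
          linarith
      · exact hcross u v hu hv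
      · rw [G.adj_comm, add_comm]
        exact hcross v u hv hu
      · have h1 := hgbig u u.2 hu
        have h2 := hgbig v v.2 hv
        obtain ⟨a, ha, hau⟩ := hnb u u.2 hu
        obtain ⟨b, hb, hbv⟩ := hnb v v.2 hv
        have h3 := hadj a u hau
        have h4 := hadj b v hbv
        constructor
        · intro _
          linarith
        · intro _
          exact hadj' u v hne (by linarith) (by linarith) (by linarith)
  · obtain ⟨σ, hσ⟩ := exists_equivFin_sorted fun x : ({v | Tp / 2 ≤ w v} : Set V) => w x
    have hU : ∀ x : ({v | Tp / 2 ≤ w v} : Set V), Tp / 2 ≤ w x := fun x => x.2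
    refine ⟨σ, fun x y z hxy hyz hxz => ?_, ?_, ?_⟩
    · rw [SimpleGraph.comap_adj, Function.Embedding.subtype_apply,
        Function.Embedding.subtype_apply] at *
      have h1 := hσ x y hxy.le
      have h2 := hσ y z hyz.le
      have h3 := hadj x z hxz
      have hx := hU x
      have hy := hU y
      have hz := hU z
      have hnexy : (x : V) ≠ y := fun h => hxy.ne (by rw [Subtype.ext h])
      have hneyz : (y : V) ≠ z := fun h => hyz.ne (by rw [Subtype.ext h])
      simp only [SimpleGraph.comap_adj, Function.Embedding.subtype_apply]
      exact ⟨hadj' x y hnexy (by linarith) (by linarith) (by linarith),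
        hadj' y z hneyz (by linarith) (by linarith) (by linarith)⟩
    · rintro v hv a b c ⟨x, hvx, rfl⟩ ⟨z, hvz, rfl⟩ hab hbc
      obtain ⟨y, rfl⟩ := σ.surjective b
      have h1 := hσ x y hab
      have h2 := hσ y z hbc
      have h3 := hadj v x hvx
      have h4 := hadj v z hvz
      have hy := hU y
      have hv' : w v < Tp / 2 := hv
      have hne : v ≠ y := fun h => by rw [← h] at hy; linarith
      exact ⟨y, hadj' v y hne (by linarith) (by linarith) (by linarith), rfl⟩
    · rintro u hu x ⟨hx, hxI⟩
      obtain ⟨v, hv, hvx⟩ := hnb x hx hxI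
      have hxU : Tp / 2 ≤ w x := not_lt.1 hxI
      have h1 := hσ u ⟨x, hxU⟩ (by rw [Fin.le_def, hu]; exact Nat.zero_le _)
      simp only at h1
      have h2 := hU u
      have h3 := hadj v x hvx
      by_cases hxu : x = u
      · exact Or.inl hxu
      · exact Or.inr (hadj' u x (Ne.symm hxu) (by linarith) (by linarith) (by linarith))

/-- In a threshold graph on `N[I]` with `I` independent, the neighborhoods of vertices of `I`
are linearly ordered by inclusion. -/
theorem neighborhoods_nested {V : Type*} {G : SimpleGraph V} {I : Set V}
    (hI : ∀ x ∈ I, ∀ y ∈ I, ¬ G.Adj x y) (hT : IsThresholdGraph (G.induce (closedNbhd G I)))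
    {v v' : V} (hv : v ∈ I) (hv' : v' ∈ I) :
    (∀ x, G.Adj v x → G.Adj v' x) ∨ (∀ x, G.Adj v' x → G.Adj v x) := by
  obtain ⟨w, T, _, _, h⟩ := hT
  by_contra! hc
  obtain ⟨⟨x, hx, hx'⟩, y, hy, hy'⟩ := hc
  have key : ∀ a (ha : a ∈ I) b (hb : b ∈ closedNbhd G I), b ∉ I →
      (G.Adj a b ↔ T ≤ w ⟨a, Or.inl ha⟩ + w ⟨b, hb⟩) := fun a ha b hb hbI =>
    h ⟨a, Or.inl ha⟩ ⟨b, hb⟩ fun hab => hbI (Subtype.mk.inj hab ▸ ha)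
  have hxc : x ∈ closedNbhd G I := Or.inr ⟨v, hv, hx⟩
  have hyc : y ∈ closedNbhd G I := Or.inr ⟨v', hv', hy⟩
  have hxI : x ∉ I := fun hx0 => hI v hv x hx0 hx
  have hyI : y ∉ I := fun hy0 => hI v' hv' y hy0 hy
  rw [key v hv x hxc hxI] at hx
  rw [key v' hv' x hxc hxI, not_le] at hx'
  rw [key v' hv' y hyc hyI] at hy
  rw [key v hv y hyc hyI, not_le] at hy'
  linarith

/-- Weights on the two parts of a partition, measured from a common center, produce a
paired threshold graph. -/
theorem isPairedThresholdGraph_of_centered {V : Type*} {G : SimpleGraph V} {I : Set V}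
    (f R : V → ℝ) {T : ℝ} (hT : 0 < T)
    (hI : ∀ x ∈ I, ∀ y ∈ I, ¬ G.Adj x y)
    (hR : ∀ v ∈ I, 0 ≤ R v ∧ 2 * R v < T) (hf : ∀ x ∉ I, -T ≤ 2 * f x)
    (hUU : ∀ x ∉ I, ∀ y ∉ I, x ≠ y → (G.Adj x y ↔ |f x - f y| ≤ T))
    (hIU : ∀ v ∈ I, ∀ x ∉ I, (G.Adj v x ↔ |f x| ≤ R v)) :
    IsPairedThresholdGraph G := by
  classical
  have hcross : ∀ v ∈ I, ∀ x ∉ I,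
      (G.Adj v x ↔ 3 * T ≤ (R v + T) + (2 * T + f x) ∧ |(R v + T) - (2 * T + f x)| ≤ T) := by
    intro v hv x hx
    have := hR v hv
    have := hf x hx
    rw [hIU v hv x hx, abs_le, abs_le]
    constructor
    · rintro ⟨h1, h2⟩
      exact ⟨by linarith, by linarith, by linarith⟩
    · rintro ⟨h1, h2, h3⟩
      exact ⟨by linarith, by linarith⟩
  refine ⟨fun x => if x ∈ I then R x + T else 2 * T + f x, 3 * T, T, fun x => ?_,
    by linarith, hT, fun u v huv => ?_⟩
  · simp only
    split_ifs with hx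
    · linarith [hR x hx]
    · linarith [hf x hx]
  · by_cases hu : u ∈ I <;> by_cases hv : v ∈ I
    · simp only [if_pos hu, if_pos hv]
      refine iff_of_false (hI u hu v hv) fun h => ?_
      linarith [hR u hu, hR v hv, h.1]
    · simp only [if_pos hu, if_neg hv]
      exact hcross u hu v hv
    · simp only [if_neg hu, if_pos hv]
      rw [G.adj_comm, add_comm, abs_sub_comm]
      exact hcross v hv u hu
    · simp only [if_neg hu, if_neg hv]
      rw [hUU u hu v hv huv, add_sub_add_left_eq_sub]
      exact ⟨fun h => ⟨by linarith [hf u hu, hf v hv], h⟩, fun h => h.2⟩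

theorem IsPairedThresholdPartition.isPairedThresholdGraph {V : Type*} [Finite V]
    {G : SimpleGraph V} {I U : Set V} (h : IsPairedThresholdPartition G I U) :
    IsPairedThresholdGraph G := by
  classical
  obtain ⟨hIU, hdisj, hI, -, hthr, σ, hσ, hcons, hfirst⟩ := h
  have hmemU : ∀ x, x ∉ I → x ∈ U := fun x hx =>
    (hIU ▸ Set.mem_univ x : x ∈ I ∪ U).resolve_left hx
  have hUI : ∀ x, x ∈ U → x ∉ I := fun x hx hx' => Set.disjoint_left.1 hdisj hx' hx
  let A : ℕ → ℕ → Prop := fun i j => ∃ x y : U, (σ x : ℕ) = i ∧ (σ y : ℕ) = j ∧ G.Adj x y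
  have hAσ : ∀ x y : U, A (σ x) (σ y) ↔ G.Adj x y := fun x y => by
    constructor
    · rintro ⟨x', y', hx, hy, hxy⟩
      rwa [σ.injective (Fin.ext hx), σ.injective (Fin.ext hy)] at hxy
    · exact fun hxy => ⟨x, y, rfl, rfl, hxy⟩
  have hA : ∀ i j l, i < j → j < l → A i l → A i j ∧ A j l := by
    rintro i j l hij hjl ⟨x, z, rfl, rfl, hxz⟩
    obtain ⟨y, hy⟩ := σ.surjective ⟨j, hjl.trans (σ z).2⟩
    have hyj : (σ y : ℕ) = j := by rw [hy]
    subst hyj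
    obtain ⟨h1, h2⟩ := hσ x y z hij hjl hxz
    exact ⟨(hAσ x y).2 h1, (hAσ y z).2 h2⟩
  let P : I → ℕ → Prop := fun v i => ∃ x : U, (σ x : ℕ) = i ∧ G.Adj v x
  have hPσ : ∀ v x, P v (σ x) ↔ G.Adj v x := fun v x => by
    constructor
    · rintro ⟨x', hx, hvx⟩
      rwa [σ.injective (Fin.ext hx)] at hvx
    · exact fun hvx => ⟨x, rfl, hvx⟩
  have hPlt : ∀ v i, P v i → i < Nat.card U := by
    rintro v i ⟨x, rfl, -⟩
    exact (σ x).2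
  have hPA : ∀ v i, P v i → i = 0 ∨ A 0 i := by
    rintro v i ⟨x, rfl, hvx⟩
    obtain ⟨u, hu⟩ := σ.surjective ⟨0, (Nat.zero_le _).trans_lt (σ x).2⟩
    have hu0 : (σ u : ℕ) = 0 := by rw [hu]
    rcases hfirst u hu0 ⟨Or.inr ⟨v, v.2, hvx⟩, hUI x x.2⟩ with h | h
    · left
      rw [Subtype.ext h, hu0]
    · right
      rw [← hu0]
      exact (hAσ u x).2 h
  let := Fintype.ofFinite I
  obtain ⟨f, R, B, hfmono, hfB, hRB, hPR⟩ := exists_strictMono_ball_representation P (Nat.card U)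
    (by
      rintro v a b c ⟨x, rfl, hx⟩ ⟨z, rfl, hz⟩ hab hbc
      obtain ⟨y, hy, hyb⟩ := hcons v v.2 (σ x) ⟨b, hbc.trans_lt (σ z).2⟩ (σ z)
        ⟨x, hx, rfl⟩ ⟨z, hz, rfl⟩ hab hbc
      exact ⟨y, by rw [hyb], hy⟩)
    hPlt
    (fun v v' => by
      rcases neighborhoods_nested hI hthr v.2 v'.2 with h | h
      · exact Or.inl fun i ⟨x, hx, hvx⟩ => ⟨x, hx, h _ hvx⟩
      · exact Or.inr fun i ⟨x, hx, hvx⟩ => ⟨x, hx, h _ hvx⟩)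
  have hAlt : ∀ j, A 0 j → j < Nat.card U := by
    rintro j ⟨_, y, -, rfl, -⟩
    exact (σ y).2
  let B' : ℝ := |(B : ℝ)|
  have hBB' : (B : ℝ) ≤ B' := le_abs_self _
  have hB'0 : 0 ≤ B' := abs_nonneg _
  have hfB' : ∀ i, i < Nat.card U → |(f i : ℝ)| ≤ B' := fun i hi => by
    have : |(f i : ℝ)| ≤ B := by exact_mod_cast hfB i hi
    linarith
  let T : ℝ := 2 * B' + 1
  have hT : 0 < T := by positivity
  obtain ⟨w, hwf, hw⟩ := exists_extend_umbrella_representation A hA (fun i => (f i : ℝ)) T hT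
    (fun i j hij hj => by
      have := hAlt j (hj.resolve_left (by omega))
      exact_mod_cast hfmono i j hij this)
    (fun i j hij hj => by
      have hjm := hAlt j (hj.resolve_left (by omega))
      have h1 := abs_le.1 (hfB' i (hij.trans hjm))
      have h2 := abs_le.1 (hfB' j hjm)
      simp only [T]
      linarith) (Nat.card U)
  have hlow : ∀ i, i < Nat.card U → -B' ≤ w i := fun i hi => by
    have h0 : -B' ≤ w 0 := by
      rw [hwf 0 (by omega) (Or.inl rfl)]
      exact (abs_le.1 (hfB' 0 (by omega))).1
    rcases Nat.eq_zero_or_pos i with rfl | h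
    · exact h0
    · exact h0.trans (hw 0 i h hi).1.le
  have hPw : ∀ v i, i < Nat.card U → (P v i ↔ |w i| ≤ R v) := fun v i hi => by
    have hRv : (R v : ℝ) ≤ B := by exact_mod_cast (hRB v).2
    by_cases hS : i = 0 ∨ A 0 i
    · rw [hwf i hi hS, hPR v i hi]
      norm_cast
    · refine iff_of_false (fun h => hS (hPA v i h)) fun h => ?_
      push Not at hS
      have h1 := (hw 0 i (by omega) hi).2.2 hS.2
      have h2 := hlow 0 (by omega)
      simp only [T] at h1
      linarith [(abs_le.1 h).2]
  let wU : V → ℝ := fun x => if hx : x ∈ U then w (σ ⟨x, hx⟩) else 0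
  let RI : V → ℝ := fun v => if hv : v ∈ I then R ⟨v, hv⟩ else 0
  have hwU : ∀ x (hx : x ∈ U), wU x = w (σ ⟨x, hx⟩) := fun x hx => dif_pos hx
  have hRI : ∀ v (hv : v ∈ I), RI v = R ⟨v, hv⟩ := fun v hv => dif_pos hv
  have hlt : ∀ x y : U, σ x < σ y → (G.Adj x y ↔ |w (σ x) - w (σ y)| ≤ T) := fun x y hxy => by
    obtain ⟨h1, h2, h3⟩ := hw (σ x) (σ y) hxy (σ y).2
    rw [hAσ] at h2 h3
    rw [abs_sub_comm, abs_of_pos (by linarith)]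
    exact ⟨fun h => (h2 h).le, fun h => by_contra fun hc => absurd (h3 hc) (not_lt.2 h)⟩
  refine isPairedThresholdGraph_of_centered wU RI hT hI (fun v hv => ?_) (fun x hx => ?_)
    (fun x hx y hy hxy => ?_) (fun v hv x hx => ?_)
  · rw [hRI v hv]
    have h1 : (0 : ℝ) ≤ R ⟨v, hv⟩ := by exact_mod_cast (hRB ⟨v, hv⟩).1
    have h2 : (R ⟨v, hv⟩ : ℝ) ≤ B := by exact_mod_cast (hRB ⟨v, hv⟩).2
    exact ⟨h1, by simp only [T]; linarith⟩
  · rw [hwU x (hmemU x hx)]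
    have := hlow _ (σ ⟨x, hmemU x hx⟩).2
    simp only [T]
    linarith
  · rw [hwU x (hmemU x hx), hwU y (hmemU y hy)]
    rcases lt_trichotomy (σ ⟨x, hmemU x hx⟩) (σ ⟨y, hmemU y hy⟩) with h | h | h
    · exact hlt _ _ h
    · exact absurd (congrArg Subtype.val (σ.injective h)) hxy
    · rw [G.adj_comm, abs_sub_comm]
      exact hlt _ _ h
  · rw [hwU x (hmemU x hx), hRI v hv, ← hPw ⟨v, hv⟩ _ (σ ⟨x, hmemU x hx⟩).2, hPσ]

/-- `G` is a paired threshold graph iff it has a paired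
threshold partition. -/
theorem paired_threshold_iff_partition {V : Type*} [Fintype V] (G : SimpleGraph V) :
    IsPairedThresholdGraph G ↔ ∃ I U : Set V, IsPairedThresholdPartition G I U :=
  ⟨fun h => h.exists_partition, fun ⟨_, _, h⟩ => h.isPairedThresholdGraph⟩
end

section
/- A finite simple graph G is a paired threshold graph if and only if at most one connected component of G induces a subgraph that is not a unit interval graph, and every connected component of G induces a paired threshold graph. -/
section PairedThreshold

variable {V : Type*} {G : SimpleGraph V}

/-- Unit interval graphs are the graphs of the relation "at distance at most one" on the line. -/
theorem isUnitIntervalGraph_iff :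
    IsUnitIntervalGraph G ↔
      ∃ l : V → ℝ, ∀ u v, u ≠ v → (G.Adj u v ↔ |l u - l v| ≤ 1) := by
  have key (a b : ℝ) : (Set.Icc a (a + 1) ∩ Set.Icc b (b + 1)).Nonempty ↔ |a - b| ≤ 1 := by
    rw [Set.Icc_inter_Icc, Set.nonempty_Icc, sup_le_iff, le_inf_iff, le_inf_iff, abs_le]
    constructor
    · rintro ⟨⟨_, _⟩, _, _⟩
      constructor <;> linarith
    · rintro ⟨_, _⟩
      refine ⟨⟨?_, ?_⟩, ?_, ?_⟩ <;> linarith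
  simp only [IsUnitIntervalGraph, key]

/-- The representing function of an induced unit interval graph extends to all vertices. -/
theorem IsUnitIntervalGraph.exists_extension {s : Set V} (h : IsUnitIntervalGraph (G.induce s)) :
    ∃ l : V → ℝ, ∀ u ∈ s, ∀ v ∈ s, u ≠ v → (G.Adj u v ↔ |l u - l v| ≤ 1) := by
  obtain ⟨l, hl⟩ := isUnitIntervalGraph_iff.1 h
  refine ⟨Function.extend Subtype.val l 0, fun u hu v hv huv => ?_⟩
  have hu' := Subtype.val_injective.extend_apply l 0 ⟨u, hu⟩
  have hv' := Subtype.val_injective.extend_apply l 0 ⟨v, hv⟩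
  have := hl ⟨u, hu⟩ ⟨v, hv⟩ (by simpa using huv)
  simp only at hu' hv'
  rw [hu', hv', ← this]
  simp

theorem IsPairedThresholdGraph.induce (h : IsPairedThresholdGraph G) (s : Set V) :
    IsPairedThresholdGraph (G.induce s) := by
  obtain ⟨w, Tp, Tm, hw, hp, hm, hadj⟩ := h
  refine ⟨fun v => w v, Tp, Tm, fun v => hw v, hp, hm, fun u v huv => ?_⟩
  simpa using hadj u v (fun h => huv (Subtype.ext h))

/-- A component that is not a unit interval graph contains a vertex of weight less than half
the sum threshold, and this vertex has a neighbor. -/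
theorem exists_light_adj_of_not_isUnitIntervalGraph {w : V → ℝ} {Tp Tm : ℝ} (hm : 0 < Tm)
    (hadj : ∀ u v, u ≠ v → (G.Adj u v ↔ Tp ≤ w u + w v ∧ |w u - w v| ≤ Tm))
    {c : G.ConnectedComponent} (hc : ¬ IsUnitIntervalGraph (G.induce c.supp)) :
    ∃ x y, G.connectedComponentMk x = c ∧ 2 * w x < Tp ∧ G.Adj x y := by
  have hscale (a b : ℝ) : |a / Tm - b / Tm| ≤ 1 ↔ |a - b| ≤ Tm := by
    rw [← sub_div, abs_div, abs_of_pos hm, div_le_one hm]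
  by_contra! hno
  refine hc (isUnitIntervalGraph_iff.2 ⟨fun v => w v / Tm, fun u v huv => ?_⟩)
  have huv' : (u : V) ≠ v := fun h => huv (Subtype.ext h)
  rw [SimpleGraph.comap_adj, hscale]
  by_cases hlight : 2 * w u < Tp ∨ 2 * w v < Tp
  · -- a light vertex would be isolated, so its component would be a single vertex
    have hiso (x y : V) (hx : x ∈ c.supp) (hy : y ∈ c.supp) (hl : 2 * w x < Tp) : x = y := by
      obtain ⟨p⟩ := SimpleGraph.ConnectedComponent.exact
        ((SimpleGraph.ConnectedComponent.mem_supp_iff _ _).1 hx |>.trans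
          ((SimpleGraph.ConnectedComponent.mem_supp_iff _ _).1 hy).symm)
      cases p with
      | nil => rfl
      | cons h _ => exact absurd h (hno x _ hx hl)
    rcases hlight with h | h
    · exact absurd (hiso u v u.2 v.2 h) huv'
    · exact absurd (hiso v u v.2 u.2 h) huv'.symm
  · push Not at hlight
    rw [Function.Embedding.subtype_apply, Function.Embedding.subtype_apply, hadj u v huv']
    exact and_iff_right (by linarith [hlight.1, hlight.2])

/-- Of two light vertices, the heavier one is adjacent to every neighbor of the lighter one. -/
theorem adj_of_light_of_le {w : V → ℝ} {Tp Tm : ℝ}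
    (hadj : ∀ u v, u ≠ v → (G.Adj u v ↔ Tp ≤ w u + w v ∧ |w u - w v| ≤ Tm))
    {x y z : V} (hy : 2 * w y < Tp) (hxy : w x ≤ w y) (hxz : G.Adj x z) : G.Adj y z := by
  obtain ⟨hs, hd⟩ := (hadj x z hxz.ne).1 hxz
  rw [abs_le] at hd
  have hlt : w y < w z := by linarith
  refine (hadj y z (fun h => hlt.ne (congrArg w h))).2 ⟨by linarith, ?_⟩
  rw [abs_le]
  constructor <;> linarith

theorem IsPairedThresholdGraph.component_eq_of_not_isUnitIntervalGraph
    (h : IsPairedThresholdGraph G) {c d : G.ConnectedComponent}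
    (hc : ¬ IsUnitIntervalGraph (G.induce c.supp))
    (hd : ¬ IsUnitIntervalGraph (G.induce d.supp)) : c = d := by
  obtain ⟨w, Tp, Tm, -, -, hm, hadj⟩ := h
  obtain ⟨x, x', rfl, hx, hxx'⟩ := exists_light_adj_of_not_isUnitIntervalGraph hm hadj hc
  obtain ⟨y, y', rfl, hy, hyy'⟩ := exists_light_adj_of_not_isUnitIntervalGraph hm hadj hd
  apply SimpleGraph.ConnectedComponent.sound
  rcases le_total (w x) (w y) with hxy | hxy
  · exact hxx'.reachable.trans (adj_of_light_of_le hadj hy hxy hxx').reachable.symm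
  · exact (adj_of_light_of_le hadj hx hxy hyy').reachable.trans hyy'.reachable.symm

/-- A paired threshold component and arbitrarily many unit interval components assemble to a
paired threshold graph: place the latter far apart from each other at large weights. -/
theorem isPairedThresholdGraph_of_components [Finite V] (c₀ : G.ConnectedComponent)
    (h₀ : IsPairedThresholdGraph (G.induce c₀.supp))
    (h : ∀ c : G.ConnectedComponent, c ≠ c₀ → IsUnitIntervalGraph (G.induce c.supp)) :
    IsPairedThresholdGraph G := by
  classical
  obtain ⟨w, Tp, Tm, hw, hp, hm, hadj⟩ := h₀
  have hext : ∀ c : G.ConnectedComponent, ∃ l : V → ℝ, c ≠ c₀ →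
      ∀ u ∈ c.supp, ∀ v ∈ c.supp, u ≠ v → (G.Adj u v ↔ |l u - l v| ≤ 1) := by
    intro c
    by_cases hc : c = c₀
    · exact ⟨0, fun h => absurd hc h⟩
    · obtain ⟨l, hl⟩ := (h c hc).exists_extension
      exact ⟨l, fun _ => hl⟩
  choose l hl using hext
  obtain ⟨n, ⟨idx⟩⟩ := Finite.exists_equiv_fin G.ConnectedComponent
  let comp : V → G.ConnectedComponent := G.connectedComponentMk
  let f : V → ℝ := fun v => if hv : comp v = c₀ then w ⟨v, hv⟩ else l (comp v) v * Tm
  let e : G.ConnectedComponent → ℕ := fun c => if c = c₀ then 0 else (idx c : ℕ) + 1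
  have he : Function.Injective e := by
    intro c d hcd
    by_cases hc : c = c₀ <;> by_cases hd : d = c₀ <;> simp [e, hc, hd] at hcd ⊢
    exact idx.injective (Fin.ext hcd)
  obtain ⟨M, hM⟩ : ∃ M, ∀ v, |f v| ≤ M := by
    obtain ⟨M, hM⟩ := (Set.finite_range fun v => |f v|).bddAbove
    exact ⟨M, fun v => hM ⟨v, rfl⟩⟩
  have hlow (v : V) : -M ≤ f v := (abs_le.1 (hM v)).1
  have hupp (v : V) : f v ≤ M := (abs_le.1 (hM v)).2
  let K : ℝ := 2 * |M| + Tm + Tp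
  have hMK : 2 * M + Tm + Tp ≤ K := by
    have := le_abs_self M
    simp only [K]
    linarith
  have hK : 0 < K := by positivity
  let W : V → ℝ := fun v => f v + K * e (comp v)
  have hpos (v : V) (hv : comp v ≠ c₀) : K ≤ K * (e (comp v) : ℝ) := by
    refine le_mul_of_one_le_right hK.le ?_
    simp [e, hv]
  have hfar (u v : V) (huv : e (comp u) < e (comp v)) : Tm < W v - W u := by
    have h1 : (e (comp u) : ℝ) + 1 ≤ e (comp v) := by exact_mod_cast huv
    have h2 := mul_le_mul_of_nonneg_left h1 hK.le
    have := hupp u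
    have := hlow v
    simp only [W]
    linarith
  refine ⟨W, Tp, Tm, fun v => ?_, hp, hm, fun u v huv => ?_⟩
  · by_cases hv : comp v = c₀
    · simpa [W, f, e, hv] using hw ⟨v, hv⟩
    · have := hpos v hv
      have := hlow v
      have : 0 ≤ M := (abs_nonneg _).trans (hM v)
      simp only [W]
      linarith
  · by_cases hcomp : comp u = comp v
    · by_cases hv : comp v = c₀
      · have hu : comp u = c₀ := hcomp.trans hv
        have := hadj ⟨u, hu⟩ ⟨v, hv⟩ (fun h => huv (congrArg Subtype.val h))
        simpa [W, f, e, hu, hv] using this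
      · have hu : comp u ≠ c₀ := hcomp ▸ hv
        have hsum : Tp ≤ W u + W v := by
          have := hpos u hu
          have := hpos v hv
          have := hlow u
          have := hlow v
          simp only [W]
          linarith
        have hdiff : W u - W v = (l (comp v) u - l (comp v) v) * Tm := by
          simp only [W, f, hcomp, hv, dif_neg, not_false_eq_true]
          ring
        rw [hl (comp v) hv u hcomp v rfl huv, and_iff_right hsum, hdiff, abs_mul, abs_of_pos hm]
        exact (mul_le_iff_le_one_left hm).symm
    · refine iff_of_false (fun hadj => ?_) (fun ⟨_, hd⟩ => ?_)
      · exact hcomp (SimpleGraph.ConnectedComponent.sound hadj.reachable)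
      · rw [abs_le] at hd
        rcases lt_or_gt_of_ne (he.ne hcomp) with hlt | hlt
        · linarith [hfar u v hlt, hd.1]
        · linarith [hfar v u hlt, hd.2]

end PairedThreshold

/-- `G` is a paired threshold graph iff at most one connected
component induces a non-unit-interval graph and every component induces a
paired threshold graph. -/
theorem paired_threshold_iff_components {V : Type*} [Fintype V] (G : SimpleGraph V) :
    IsPairedThresholdGraph G ↔
      ((∀ c : G.ConnectedComponent, IsPairedThresholdGraph (G.induce c.supp)) ∧
        ∀ c d : G.ConnectedComponent,
          ¬ IsUnitIntervalGraph (G.induce c.supp) →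
          ¬ IsUnitIntervalGraph (G.induce d.supp) → c = d) := by
  refine ⟨fun h => ⟨fun c => h.induce _, fun c d hc hd =>
    h.component_eq_of_not_isUnitIntervalGraph hc hd⟩, fun ⟨hpt, huniq⟩ => ?_⟩
  by_cases hex : ∃ c₀ : G.ConnectedComponent, ¬ IsUnitIntervalGraph (G.induce c₀.supp)
  · obtain ⟨c₀, hc₀⟩ := hex
    refine isPairedThresholdGraph_of_components c₀ (hpt c₀) fun c hc => ?_
    by_contra hnot
    exact hc (huniq c c₀ hnot hc₀)
  · push Not at hex
    rcases isEmpty_or_nonempty V with hV | ⟨⟨v⟩⟩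
    · exact ⟨0, 1, 1, isEmptyElim, one_pos, one_pos, isEmptyElim⟩
    · exact isPairedThresholdGraph_of_components (G.connectedComponentMk v) (hpt _)
        fun c _ => hex c
end

section
/- Let I ⊎ U be a canonical paired threshold partition of a paired threshold graph G, and let v ∈ U ∖ N(I) be a simplicial vertex of G. Then N(I) is not a subset of N(v). -/
/-- A finite split graph whose independent part has nested neighborhoods is a threshold graph. -/
theorem isThresholdGraph_of_nested {W : Type*} [Finite W] (H : SimpleGraph W) (S : Set W)
    (hclique : ∀ a ∉ S, ∀ b ∉ S, a ≠ b → H.Adj a b)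
    (hindep : ∀ a ∈ S, ∀ b ∈ S, ¬ H.Adj a b)
    (hnest : ∀ a ∈ S, ∀ b ∈ S,
      H.neighborSet a ⊆ H.neighborSet b ∨ H.neighborSet b ⊆ H.neighborSet a) :
    IsThresholdGraph H := by
  classical
  set N : ℕ := Nat.card W + 1 with hN
  let c : W → ℕ := fun s => {t | t ∈ S ∧ H.neighborSet s ⊆ H.neighborSet t}.ncard
  let e : W → ℕ := fun k => {t | t ∈ S ∧ H.Adj k t}.ncard
  have hcN : ∀ s, c s < N := fun s => Nat.lt_succ_of_le (Set.ncard_le_card _)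
  have hcpos : ∀ s ∈ S, 0 < c s := fun s hs =>
    (Set.ncard_pos (Set.toFinite _)).2 ⟨s, hs, subset_rfl⟩
  have key : ∀ k, ∀ s ∈ S, (H.Adj k s ↔ c s ≤ e k) := by
    intro k s hs
    constructor
    · intro h
      exact Set.ncard_le_ncard (fun t ht => ⟨ht.1, (ht.2 h.symm : H.Adj t k).symm⟩)
        (Set.toFinite _)
    · intro h
      by_contra hks
      refine absurd h (not_le.2 (Set.ncard_lt_ncard ?_ (Set.toFinite _)))
      refine ⟨fun t ht => ⟨ht.1, ?_⟩, fun hsub => hks (hsub ⟨hs, subset_rfl⟩).2⟩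
      exact (hnest s hs t ht.1).resolve_right fun h' =>
        hks (h' (show k ∈ H.neighborSet t from ht.2.symm) : H.Adj s k).symm
  refine ⟨fun a => if a ∈ S then (N : ℝ) - c a else N + e a, 2 * N, fun a => ?_, ?_, ?_⟩
  · have : (c a : ℝ) < N := by exact_mod_cast hcN a
    dsimp only
    split_ifs
    · linarith
    · positivity
  · positivity
  · intro a b hab
    dsimp only
    split_ifs with ha hb hb
    · have h1 : (0 : ℝ) < c a := by exact_mod_cast hcpos a ha
      have h2 : (0 : ℝ) < c b := by exact_mod_cast hcpos b hb
      exact iff_of_false (hindep a ha b hb) (by linarith)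
    · rw [H.adj_comm, key b a ha, ← Nat.cast_le (α := ℝ)]
      constructor <;> intro h <;> linarith
    · rw [key a b hb, ← Nat.cast_le (α := ℝ)]
      constructor <;> intro h <;> linarith
    · refine iff_of_true (hclique a ha b hb hab) ?_
      have h1 : (0 : ℝ) ≤ e a := by positivity
      have h2 : (0 : ℝ) ≤ e b := by positivity
      linarith

/-- An injective ranking of a finite type can be compressed to an enumeration. -/
theorem exists_equiv_fin_lt_iff {W : Type*} [Finite W] (f : W → ℕ)
    (hf : Function.Injective f) :
    ∃ σ : W ≃ Fin (Nat.card W), ∀ a b, σ a < σ b ↔ f a < f b := by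
  classical
  have := Fintype.ofFinite W
  let _ : LinearOrder W := LinearOrder.lift' f hf
  let g := (Fintype.orderIsoFinOfCardEq W (Nat.card_eq_fintype_card (α := W)).symm).symm
  exact ⟨g.toEquiv, fun a b => g.lt_iff_lt⟩

/-- In a paired threshold partition, the neighborhoods of vertices of `I` are nested. -/
theorem IsPairedThresholdPartition.adj_nested {V : Type*} {G : SimpleGraph V} {I U : Set V}
    (h : IsPairedThresholdPartition G I U) {a b : V} (ha : a ∈ I) (hb : b ∈ I) :
    G.neighborSet a ⊆ G.neighborSet b ∨ G.neighborSet b ⊆ G.neighborSet a := by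
  obtain ⟨-, -, hind, -, ⟨w, T, -, -, hw⟩, -⟩ := h
  have main : ∀ a (ha : a ∈ I), ∀ b (hb : b ∈ I), w ⟨a, Or.inl ha⟩ ≤ w ⟨b, Or.inl hb⟩ →
      G.neighborSet a ⊆ G.neighborSet b := by
    intro a ha b hb hle z (hz : G.Adj a z)
    have hzI : z ∉ I := fun hzI => hind a ha z hzI hz
    have hzN : z ∈ closedNbhd G I := Or.inr ⟨a, ha, hz⟩
    have hbz : b ≠ z := fun h => hzI (h ▸ hb)
    have h1 := (hw ⟨a, Or.inl ha⟩ ⟨z, hzN⟩ fun h => hz.ne (Subtype.mk.inj h)).1 hz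
    exact (hw ⟨b, Or.inl hb⟩ ⟨z, hzN⟩ fun h => hbz (Subtype.mk.inj h)).2 (by linarith)
  exact (le_total _ _).imp (main a ha b hb) (main b hb a ha)

/-- In an umbrella ordering, the neighbors of a vertex together with the vertex itself are
consecutive. -/
theorem IsUmbrellaOrdering.adj_of_between {W : Type*} {H : SimpleGraph W}
    {σ : W ≃ Fin (Nat.card W)} (hσ : IsUmbrellaOrdering H σ) {x a b c : W}
    (hxa : H.Adj x a) (hxc : H.Adj x c) (hab : σ a < σ b) (hbc : σ b < σ c) (hbx : b ≠ x) :
    H.Adj x b := by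
  rcases lt_or_gt_of_ne (fun h => hbx (σ.injective h)) with h | h
  · exact (hσ a b x hab h hxa.symm).2.symm
  · exact (hσ x b c h hbc hxc).1

/-- Sufficient conditions for moving a simplicial vertex of `U` into `I`. -/
theorem IsPairedThresholdPartition.insert_of_isSimplicial {V : Type*} [Finite V]
    {G : SimpleGraph V} {I U : Set V}
    (h : IsPairedThresholdPartition G I U) {x : V} (hxU : x ∈ U) (hxN : x ∉ openNbhd G I)
    (hsimp : IsSimplicial G x) (hsub : openNbhd G I ⊆ G.neighborSet x)
    (σ : ↥U ≃ Fin (Nat.card ↥U)) (hσ : IsUmbrellaOrdering (G.induce U) σ)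
    (hcons : ∀ v ∈ I, ∀ a b c : Fin (Nat.card ↥U),
      (∃ x : ↥U, G.Adj v ↑x ∧ σ x = a) → (∃ x : ↥U, G.Adj v ↑x ∧ σ x = c) →
      a ≤ b → b ≤ c → ∃ x : ↥U, G.Adj v ↑x ∧ σ x = b)
    (hfirst : ∀ u : ↥U, u.1 ≠ x → (∀ y : ↥U, y.1 ≠ x → σ u ≤ σ y) →
      G.neighborSet x ⊆ insert u.1 (G.neighborSet u.1)) :
    IsPairedThresholdPartition G (insert x I) (U \ {x}) := by
  have hnest := fun {a b} => h.adj_nested (a := a) (b := b)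
  obtain ⟨huniv, hdisj, hind, ⟨l, hl⟩, -, -⟩ := h
  have hxI : x ∉ I := fun hx => hdisj.le_bot ⟨hx, hxU⟩
  have hxadj : ∀ a ∈ I, ¬ G.Adj a x := fun a ha hax => hxN ⟨Or.inr ⟨a, ha, hax⟩, hxI⟩
  have hnbr : ∀ a ∈ I, G.neighborSet a ⊆ G.neighborSet x := fun a ha z hz =>
    hsub ⟨Or.inr ⟨a, ha, hz⟩, fun hzI => hind a ha z hzI hz⟩
  have hnbr' : ∀ a ∈ insert x I, G.neighborSet a ⊆ G.neighborSet x := by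
    rintro a (rfl | ha)
    exacts [subset_rfl, hnbr a ha]
  have hind' : ∀ a ∈ insert x I, ∀ b ∈ insert x I, ¬ G.Adj a b := by
    rintro a (rfl | ha) b (rfl | hb) hab
    exacts [hab.ne rfl, hxadj b hb hab.symm, hxadj a ha hab, hind a ha b hb hab]
  have hnest' : ∀ a ∈ insert x I, ∀ b ∈ insert x I,
      G.neighborSet a ⊆ G.neighborSet b ∨ G.neighborSet b ⊆ G.neighborSet a := by
    rintro a (rfl | ha) b hb
    · exact Or.inr (hnbr' b hb)
    · rcases hb with rfl | hb
      exacts [Or.inl (hnbr a ha), hnest ha hb]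
  have hN : ∀ z ∈ closedNbhd G (insert x I), z ∉ insert x I → G.Adj x z := by
    rintro z (hz | ⟨a, ha, haz⟩) hzI
    exacts [absurd hz hzI, hnbr' a ha haz]
  obtain ⟨τ, hτ⟩ := exists_equiv_fin_lt_iff
    (fun y : ↥(U \ {x}) => (σ ⟨y.1, y.2.1⟩ : ℕ))
    (fun a b hab => Subtype.ext (Subtype.mk.inj (σ.injective (Fin.ext hab))))
  have hτ' : ∀ a b : ↥(U \ {x}), τ a ≤ τ b ↔ σ ⟨a.1, a.2.1⟩ ≤ σ ⟨b.1, b.2.1⟩ := fun a b => by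
    rw [← not_lt, hτ, ← not_lt]; rfl
  refine ⟨?_, ?_, hind', ?_, ?_, τ, ?_, ?_, ?_⟩
  · refine Set.eq_univ_of_forall fun z => ?_
    have hz : z ∈ I ∪ U := huniv ▸ Set.mem_univ z
    by_cases hzx : z = x
    · exact Or.inl (Or.inl hzx)
    · exact hz.imp Or.inr fun hzU => ⟨hzU, hzx⟩
  · rw [Set.disjoint_left]
    rintro z (rfl | hz) ⟨hzU, hzx⟩
    exacts [hzx rfl, hdisj.le_bot ⟨hz, hzU⟩]
  · exact ⟨fun y => l ⟨y.1, y.2.1⟩, fun a b hab => hl ⟨a.1, a.2.1⟩ ⟨b.1, b.2.1⟩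
      fun h => hab (Subtype.ext (Subtype.mk.inj h))⟩
  · refine isThresholdGraph_of_nested _ {a | a.1 ∈ insert x I} ?_ ?_ ?_
    · exact fun a ha b hb hab => hsimp (Or.inr (hN a.1 a.2 ha)) (Or.inr (hN b.1 b.2 hb))
        fun h => hab (Subtype.ext h)
    · exact fun a ha b hb => hind' a ha b hb
    · exact fun a ha b hb => (hnest' a ha b hb).imp (fun h z hz => h hz) (fun h z hz => h hz)
  · exact fun a b c hab hbc hac => hσ ⟨a.1, a.2.1⟩ ⟨b.1, b.2.1⟩ ⟨c.1, c.2.1⟩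
      ((hτ a b).1 hab) ((hτ b c).1 hbc) hac
  · rintro v hv _ b _ ⟨p, hp, rfl⟩ ⟨q, hq, rfl⟩ hpb hbq
    obtain ⟨y, rfl⟩ := τ.surjective b
    refine ⟨y, ?_, rfl⟩
    rw [hτ'] at hpb hbq
    rcases hv with rfl | hv
    · rcases hpb.eq_or_lt with hpy | hpy
      · rwa [← congrArg Subtype.val (σ.injective hpy)]
      rcases hbq.eq_or_lt with hyq | hyq
      · rwa [congrArg Subtype.val (σ.injective hyq)]
      exact hσ.adj_of_between (x := ⟨v, hxU⟩) (a := ⟨p.1, p.2.1⟩) (b := ⟨y.1, y.2.1⟩)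
        (c := ⟨q.1, q.2.1⟩) hp hq hpy hyq
        fun h => y.2.2 (congrArg Subtype.val h)
    · obtain ⟨z, hz, hzy⟩ := hcons v hv _ _ _ ⟨⟨p.1, p.2.1⟩, hp, rfl⟩
        ⟨⟨q.1, q.2.1⟩, hq, rfl⟩ hpb hbq
      rwa [σ.injective hzy] at hz
  · rintro u hu z ⟨hz, hzI⟩
    refine hfirst ⟨u.1, u.2.1⟩ u.2.2 (fun y hy => ?_) (hN z hz hzI)
    exact (hτ' u ⟨y.1, y.2, hy⟩).1 (Fin.le_def.2 (by omega))

/-- If `I ⊎ U` is a canonical paired threshold partition of a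
paired threshold graph `G` and `v ∈ U ∖ N(I)` is simplicial, then
`N(I) ⊄ N(v)`. -/
theorem canonical_partition_neighborhood_not_subset {V : Type*} [Fintype V]
    (G : SimpleGraph V) (hG : IsPairedThresholdGraph G) (I U : Set V)
    (hcan : IsCanonicalPTPartition G I U) (v : V) (hvU : v ∈ U)
    (hvN : v ∉ openNbhd G I) (hsimp : IsSimplicial G v) :
    ¬ openNbhd G I ⊆ G.neighborSet v := by
  intro hsub
  obtain ⟨hpart, hmax⟩ := hcan
  obtain ⟨huniv, hdisj, -, -, -, σ, hσ, hcons, hfirst⟩ := id hpart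
  have hpos : 0 < Nat.card ↥U := (Nat.zero_le _).trans_lt (σ ⟨v, hvU⟩).2
  obtain ⟨u, hu⟩ := σ.surjective ⟨0, hpos⟩
  have hu0 : (σ u : ℕ) = 0 := by rw [hu]
  have hlt : ∀ y : ↥U, y ≠ u → σ u < σ y := fun y hy =>
    lt_of_le_of_ne (Fin.le_def.2 (by omega)) fun h => hy (σ.injective h.symm)
  by_cases huN : u.1 ∈ openNbhd G I
  · refine hmax v hvU (hpart.insert_of_isSimplicial hvU hvN hsimp hsub σ hσ hcons ?_)
    intro y _ hymin z hz
    have huv : u.1 ≠ v := fun h => hvN (h ▸ huN)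
    have hyu : y = u := by
      by_contra hne
      exact absurd (hymin u huv) (not_le.2 (hlt y hne))
    subst hyu
    by_cases hzy : z = y.1
    · exact Or.inl hzy
    · exact Or.inr (hsimp (Or.inr (hsub huN)) (Or.inr hz) (Ne.symm hzy))
  · have huI : u.1 ∉ I := fun h => hdisj.le_bot ⟨h, u.2⟩
    have hnU : ∀ z, G.Adj u.1 z → z ∈ U := fun z hz =>
      (huniv ▸ Set.mem_univ z : z ∈ I ∪ U).resolve_left fun hzI =>
        huN ⟨Or.inr ⟨z, hzI, hz.symm⟩, huI⟩
    have hnlt : ∀ z (hz : G.Adj u.1 z), σ u < σ ⟨z, hnU z hz⟩ := fun z hz =>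
      hlt _ fun h => hz.ne (congrArg Subtype.val h).symm
    have hclique : ∀ a b, G.Adj u.1 a → G.Adj u.1 b → a ≠ b → G.Adj a b := by
      intro a b ha hb hab
      rcases lt_or_gt_of_ne (a := σ ⟨a, hnU a ha⟩) (b := σ ⟨b, hnU b hb⟩)
        fun h => hab (congrArg Subtype.val (σ.injective h)) with h | h
      · exact (hσ u ⟨a, hnU a ha⟩ ⟨b, hnU b hb⟩ (hnlt a ha) h hb).2
      · exact (hσ u ⟨b, hnU b hb⟩ ⟨a, hnU a ha⟩ (hnlt b hb) h ha).2.symm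
    refine hmax u.1 u.2 (hpart.insert_of_isSimplicial u.2 huN ?_ ?_ σ hσ hcons ?_)
    · rintro a (rfl | ha) b (rfl | hb) hab
      exacts [absurd rfl hab, hb, G.adj_symm ha, hclique a b ha hb hab]
    · intro z hz
      exact (hfirst u hu0 hz).resolve_left fun h => huN (h ▸ hz)
    · intro y hy hymin z hz
      have hzU := hnU z hz
      rcases (hymin ⟨z, hzU⟩ (G.ne_of_adj hz).symm).eq_or_lt with h | h
      · exact Or.inl (congrArg Subtype.val (σ.injective h)).symm
      · exact Or.inr (hσ u y ⟨z, hzU⟩ (hlt y fun h => hy (congrArg Subtype.val h)) h hz).2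
end
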